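/- Let k ≥ 1 be a constant integer and suppose K_n → ∞, K_n²/P_n → 0, and p_{e,q}(n) = (ln n + (k−1)·ln ln n + b·ln ln n + β_n)/n, where b is a constant integer with k + b ≥ 1 and the real sequence β_n satisfies −1 < liminf_{n→∞} β_n/ln ln n ≤ limsup_{n→∞} β_n/ln ln n < 1. If β_n → β* for a finite β* ∈ ℝ, then as n → ∞ the probability that the minimum degree δ_n of 𝔾_q(n,K_n,P_n,p_n) equals k+b converges to exp(−e^{−β*}/(k+b−1)!) and the probability that δ_n equals k+b−1 converges to 1 − exp(−e^{−β*}/(k+b−1)!). -/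

import Mathlib

open Finset Filter

/-- A configuration of the random graph `𝔾_q(n,K,P,p)`: a key-ring assignment
(one finite subset of the key pool `Fin P` per vertex) together with the
on/off states of the channels (one Boolean per unordered pair of vertices). -/
abbrev Config (n P : ℕ) : Type := (Fin n → Finset (Fin P)) × (Sym2 (Fin n) → Bool)

/-- Probability weight of a configuration: the key rings are independent and
uniform over the `K`-element subsets of the pool of size `P`, and the channels
are independent Bernoulli(`p`). -/
noncomputable def weight (n K P : ℕ) (p : ℝ) (ω : Config n P) : ℝ :=
  (∏ i : Fin n, if (ω.1 i).card = K then ((P.choose K : ℝ))⁻¹ else 0) *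
  (∏ e : Sym2 (Fin n), if ω.2 e then p else 1 - p)

/-- Probability of an event in `𝔾_q(n,K,P,p)`. -/
noncomputable def prob (n K P : ℕ) (p : ℝ) (E : Set (Config n P)) : ℝ :=
  ∑ ω : Config n P, Set.indicator E (weight n K P p) ω

/-- Adjacency in `𝔾_q(n,K,P,p)`: two distinct vertices are adjacent iff their
key rings share at least `q` keys and the channel between them is on. -/
def Adj (q n P : ℕ) (ω : Config n P) (i j : Fin n) : Prop :=
  i ≠ j ∧ q ≤ ((ω.1 i) ∩ (ω.1 j)).card ∧ ω.2 s(i, j) = true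

/-- Degree of a vertex. -/
noncomputable def degree (q n P : ℕ) (ω : Config n P) (i : Fin n) : ℕ :=
  Nat.card {j : Fin n // Adj q n P ω i j}

/-- Minimum degree of the graph. -/
noncomputable def minDeg (q n P : ℕ) (ω : Config n P) : ℕ :=
  sInf (Set.range fun i => degree q n P ω i)

/-- `p_{s,q}`: the probability that two key rings share at least `q` keys. -/
noncomputable def psq (q K P : ℕ) : ℝ :=
  1 - ∑ u ∈ Finset.range q,
    ((K.choose u : ℝ) * ((P - K).choose (K - u) : ℝ)) / (P.choose K : ℝ)

/-- `p_{e,q}`: the probability that two distinct vertices are adjacent. -/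
noncomputable def peq (q K P : ℕ) (p : ℝ) : ℝ := p * psq q K P

set_option linter.unusedSectionVars false

section KeyRing

variable {α : Type*} [Fintype α] [DecidableEq α]

/-- Probability that a uniformly random `K`-subset of `α` equals `s`. -/
noncomputable def ringWeight (α : Type*) [Fintype α] (K : ℕ) (s : Finset α) : ℝ :=
  if s.card = K then (((Fintype.card α).choose K : ℝ))⁻¹ else 0

lemma ringWeight_nonneg (K : ℕ) (s : Finset α) : 0 ≤ ringWeight α K s := by
  unfold ringWeight; split_ifs <;> positivity

lemma sum_ringWeight_ite (K : ℕ) (Q : Finset α → Prop) [DecidablePred Q] :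
    ∑ s, ringWeight α K s * (if Q s then 1 else 0)
      = (#{s : Finset α | s.card = K ∧ Q s} : ℝ) * (((Fintype.card α).choose K : ℝ))⁻¹ := by
  simp only [ringWeight, mul_ite, mul_one, mul_zero, ← ite_and]
  rw [← Finset.sum_filter, Finset.sum_const, nsmul_eq_mul]
  congr 3
  ext s; simp [and_comm]

lemma sum_ringWeight {K : ℕ} (hK : K ≤ Fintype.card α) : ∑ s, ringWeight α K s = 1 := by
  have h := sum_ringWeight_ite (α := α) K (fun _ => True)
  simp only [if_true, mul_one, and_true] at h
  rw [h]
  have : #{s : Finset α | s.card = K} = (Fintype.card α).choose K := by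
    rw [← Finset.card_univ (α := α), ← Finset.card_powersetCard]
    congr 1; ext s; simp [Finset.mem_powersetCard]
  rw [this]
  have : (0 : ℝ) < (Fintype.card α).choose K := by exact_mod_cast Nat.choose_pos hK
  field_simp

lemma descFactorial_mul_pow_le {K N : ℕ} (hK : K ≤ N) (a : ℕ) :
    K.descFactorial a * N ^ a ≤ N.descFactorial a * K ^ a := by
  induction a with
  | zero => simp
  | succ a ih =>
    rw [Nat.descFactorial_succ, Nat.descFactorial_succ, pow_succ, pow_succ]
    have h : (K - a) * N ≤ (N - a) * K := by
      rw [Nat.sub_mul, Nat.sub_mul, mul_comm N K]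
      exact Nat.sub_le_sub_left (Nat.mul_le_mul_left a hK) _
    calc (K - a) * K.descFactorial a * (N ^ a * N)
        = ((K - a) * N) * (K.descFactorial a * N ^ a) := by ring
      _ ≤ ((N - a) * K) * (N.descFactorial a * K ^ a) := Nat.mul_le_mul h ih
      _ = _ := by ring

/-- The probability that a random `K`-subset contains a given set `A`. -/
lemma sum_ringWeight_superset_le {K : ℕ} (hK : K ≤ Fintype.card α) (A : Finset α) :
    ∑ s, ringWeight α K s * (if A ⊆ s then 1 else 0) ≤ ((K : ℝ) / Fintype.card α) ^ A.card := by
  rw [sum_ringWeight_ite]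
  set N := Fintype.card α with hN
  by_cases hA : A.card ≤ K
  swap
  · have : #{s : Finset α | s.card = K ∧ A ⊆ s} = 0 := by
      rw [Finset.card_eq_zero, Finset.filter_eq_empty_iff]
      rintro s - ⟨h1, h2⟩
      exact hA (h1 ▸ Finset.card_le_card h2)
    rw [this]; simp; positivity
  have hcard : #{s : Finset α | s.card = K ∧ A ⊆ s} ≤ (N - A.card).choose (K - A.card) := by
    rw [hN, ← Finset.card_compl, ← Finset.card_powersetCard]
    refine Finset.card_le_card_of_injOn (fun s => s \ A) ?_ ?_
    · intro s hs
      simp only [Finset.coe_filter, Finset.mem_univ, true_and, Set.mem_ofPred_eq] at hs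
      simp only [Finset.mem_coe, Finset.mem_powersetCard]
      refine ⟨fun x hx => by simp at hx ⊢; exact hx.2, ?_⟩
      rw [Finset.card_sdiff_of_subset hs.2, hs.1]
    · intro s hs t ht hst
      simp only [Finset.coe_filter, Finset.mem_univ, true_and, Set.mem_ofPred_eq] at hs ht
      simp only at hst
      rw [← Finset.sdiff_union_of_subset hs.2, hst, Finset.sdiff_union_of_subset ht.2]
  have hAN : A.card ≤ N := hA.trans hK
  have h1 : N.choose K * K.choose A.card = N.choose A.card * (N - A.card).choose (K - A.card) :=
    Nat.choose_mul hA
  have h2 := descFactorial_mul_pow_le hK A.card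
  rw [Nat.descFactorial_eq_factorial_mul_choose, Nat.descFactorial_eq_factorial_mul_choose] at h2
  have h2' : K.choose A.card * N ^ A.card ≤ N.choose A.card * K ^ A.card := by
    have := Nat.factorial_pos A.card
    have h3 : A.card.factorial * (K.choose A.card * N ^ A.card)
        ≤ A.card.factorial * (N.choose A.card * K ^ A.card) := by linarith
    exact Nat.le_of_mul_le_mul_left h3 this
  have hpos1 : (0 : ℝ) < N.choose K := by exact_mod_cast Nat.choose_pos hK
  have hpos2 : (0 : ℝ) < N.choose A.card := by exact_mod_cast Nat.choose_pos hAN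
  have hNpow : (0 : ℝ) < (N : ℝ) ^ A.card := by
    rcases Nat.eq_zero_or_pos N with h | h
    · have : A.card = 0 := by omega
      simp [this]
    · positivity
  have h1' : (N.choose K : ℝ) * K.choose A.card
      = N.choose A.card * (N - A.card).choose (K - A.card) := by exact_mod_cast h1
  have h2'' : (K.choose A.card : ℝ) * N ^ A.card ≤ N.choose A.card * K ^ A.card := by
    exact_mod_cast h2'
  have hc' : (#{s : Finset α | s.card = K ∧ A ⊆ s} : ℝ) ≤ (N - A.card).choose (K - A.card) := by
    exact_mod_cast hcard
  calc (#{s : Finset α | s.card = K ∧ A ⊆ s} : ℝ) * (N.choose K : ℝ)⁻¹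
      ≤ ((N - A.card).choose (K - A.card) : ℝ) * (N.choose K : ℝ)⁻¹ := by gcongr
    _ = (K.choose A.card : ℝ) / N.choose A.card := by
        field_simp; linarith
    _ ≤ _ := by
        rw [div_pow, div_le_div_iff₀ hpos2 hNpow]; linarith

/-- Exponential moment of the intersection with a fixed `K`-subset. -/
lemma sum_ringWeight_pow_inter_le {K : ℕ} (hK : K ≤ Fintype.card α) (t : Finset α)
    (ht : t.card = K) {y : ℝ} (hy : 0 ≤ y) :
    ∑ s, ringWeight α K s * (1 + y) ^ (s ∩ t).card
      ≤ Real.exp (y * ((K : ℝ) ^ 2 / Fintype.card α)) := by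
  have h1 : ∀ s : Finset α, (1 + y) ^ (s ∩ t).card
      = ∑ A ∈ t.powerset, y ^ A.card * (if A ⊆ s then 1 else 0) := by
    intro s
    have := Finset.prod_one_add (f := fun _ : α => y) (s ∩ t)
    simp only [Finset.prod_const] at this
    rw [this]
    simp only [mul_ite, mul_one, mul_zero]
    rw [← Finset.sum_filter]
    refine Finset.sum_congr ?_ fun _ _ => rfl
    ext A
    simp only [Finset.mem_powerset, Finset.mem_filter, Finset.subset_inter_iff]
    tauto
  calc ∑ s, ringWeight α K s * (1 + y) ^ (s ∩ t).card
      = ∑ A ∈ t.powerset, y ^ A.card * ∑ s, ringWeight α K s * (if A ⊆ s then 1 else 0) := by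
        simp_rw [h1, Finset.mul_sum]
        rw [Finset.sum_comm]
        refine Finset.sum_congr rfl fun _ _ => Finset.sum_congr rfl fun _ _ => by ring
    _ ≤ ∑ A ∈ t.powerset, y ^ A.card * ((K : ℝ) / Fintype.card α) ^ A.card := by
        gcongr with A hA
        exact sum_ringWeight_superset_le hK A
    _ = (1 + y * ((K : ℝ) / Fintype.card α)) ^ t.card := by
        have := Finset.prod_one_add (f := fun _ : α => y * ((K : ℝ) / Fintype.card α)) t
        simp only [Finset.prod_const] at this
        rw [this]
        exact Finset.sum_congr rfl fun _ _ => by rw [mul_pow]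
    _ ≤ (Real.exp (y * ((K : ℝ) / Fintype.card α))) ^ t.card := by
        gcongr
        rw [add_comm]; exact Real.add_one_le_exp _
    _ = _ := by
        rw [← Real.exp_nat_mul, ht]; congr 1; ring

/-- The probability that a random `K`-subset meets a fixed set. -/
lemma sum_ringWeight_meets_le {K : ℕ} (hK : K ≤ Fintype.card α) (t : Finset α)
    (ht : t.card = K) :
    ∑ s, ringWeight α K s * (if Disjoint s t then 0 else 1) ≤ (K : ℝ) ^ 2 / Fintype.card α := by
  have h1 : ∀ s : Finset α, (if Disjoint s t then (0 : ℝ) else 1)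
      ≤ ∑ x ∈ t, (if {x} ⊆ s then 1 else 0) := by
    intro s
    split_ifs with h
    · exact Finset.sum_nonneg fun _ _ => by split_ifs <;> norm_num
    · obtain ⟨x, hxs, hxt⟩ := Finset.not_disjoint_iff.1 h
      calc (1 : ℝ) = if {x} ⊆ s then 1 else 0 := by simp [hxs]
        _ ≤ _ := Finset.single_le_sum (f := fun x => if {x} ⊆ s then (1 : ℝ) else 0)
            (fun _ _ => by split_ifs <;> norm_num) hxt
  calc _ ≤ ∑ s, ringWeight α K s * ∑ x ∈ t, (if {x} ⊆ s then (1 : ℝ) else 0) := by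
        gcongr with s _
        · exact ringWeight_nonneg K s
        · exact h1 s
    _ = ∑ x ∈ t, ∑ s, ringWeight α K s * (if {x} ⊆ s then (1 : ℝ) else 0) := by
        simp_rw [Finset.mul_sum]; rw [Finset.sum_comm]
    _ ≤ ∑ x ∈ t, ((K : ℝ) / Fintype.card α) := by
        gcongr with x _
        simpa using sum_ringWeight_superset_le hK {x}
    _ = _ := by
        rw [Finset.sum_const, nsmul_eq_mul, ht]; ring

lemma card_powersetCard_meets_le (q : ℕ) (t t' : Finset α) :
    #{A ∈ t.powersetCard (q + 1) | ¬ Disjoint A t'} ≤ (t ∩ t').card * t.card ^ q := by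
  have hsub : {A ∈ t.powersetCard (q + 1) | ¬ Disjoint A t'} ⊆
      ((t ∩ t') ×ˢ t.powersetCard q).image (fun z => insert z.1 z.2) := by
    intro A hA
    simp only [Finset.mem_filter, Finset.mem_powersetCard] at hA
    obtain ⟨⟨hAt, hAc⟩, hd⟩ := hA
    obtain ⟨x, hxA, hxt⟩ := Finset.not_disjoint_iff.1 hd
    simp only [Finset.mem_image, Finset.mem_product, Finset.mem_powersetCard, Prod.exists]
    refine ⟨x, A.erase x, ⟨by simp [hAt hxA, hxt], (Finset.erase_subset _ _).trans hAt, ?_⟩,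
      Finset.insert_erase hxA⟩
    rw [Finset.card_erase_of_mem hxA, hAc]; rfl
  calc _ ≤ _ := Finset.card_le_card hsub
    _ ≤ _ := Finset.card_image_le
    _ ≤ _ := by
      rw [Finset.card_product, Finset.card_powersetCard]
      gcongr
      exact Nat.choose_le_pow _ _

/-- The probability that a random `K`-subset shares at least `q + 1` elements with each of two
fixed `K`-subsets. -/
lemma sum_ringWeight_both_le {K : ℕ} (hK1 : 1 ≤ K) (hK : K ≤ Fintype.card α) (q : ℕ)
    (t t' : Finset α) (ht : t.card = K) (ht' : t'.card = K) :
    ∑ s, ringWeight α K s * (if q + 1 ≤ (t ∩ s).card ∧ q + 1 ≤ (t' ∩ s).card then 1 else 0)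
      ≤ ((t ∩ t').card / (K : ℝ)) * ((K : ℝ) ^ 2 / Fintype.card α) ^ (q + 1)
        + (((K : ℝ) ^ 2 / Fintype.card α) ^ (q + 1)) ^ 2 := by
  set N := Fintype.card α with hN
  set F := {A ∈ t.powersetCard (q + 1) | ¬ Disjoint A t'} with hF
  set G := {z ∈ t.powersetCard (q + 1) ×ˢ t'.powersetCard (q + 1) | Disjoint z.1 z.2} with hG
  have hnn : ∀ (p : Prop) [Decidable p], (0 : ℝ) ≤ if p then 1 else 0 := by
    intro p _; split_ifs <;> norm_num
  have h1 : ∀ s : Finset α, (if q + 1 ≤ (t ∩ s).card ∧ q + 1 ≤ (t' ∩ s).card then (1 : ℝ) else 0)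
      ≤ ∑ A ∈ F, (if A ⊆ s then 1 else 0) + ∑ z ∈ G, (if z.1 ∪ z.2 ⊆ s then 1 else 0) := by
    intro s
    split_ifs with h
    swap
    · exact add_nonneg (Finset.sum_nonneg fun _ _ => hnn _) (Finset.sum_nonneg fun _ _ => hnn _)
    obtain ⟨A, hA, hAc⟩ := Finset.exists_subset_card_eq h.1
    obtain ⟨B, hB, hBc⟩ := Finset.exists_subset_card_eq h.2
    rw [Finset.subset_inter_iff] at hA hB
    by_cases hd : Disjoint A t'
    · have hz : (A, B) ∈ G := by
        simp only [hG, Finset.mem_filter, Finset.mem_product, Finset.mem_powersetCard]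
        exact ⟨⟨⟨hA.1, hAc⟩, hB.1, hBc⟩, hd.mono_right hB.1⟩
      have h2 := Finset.single_le_sum (f := fun z : Finset α × Finset α =>
        if z.1 ∪ z.2 ⊆ s then (1 : ℝ) else 0) (fun _ _ => hnn _) hz
      rw [if_pos (Finset.union_subset hA.2 hB.2)] at h2
      have h3 : (0 : ℝ) ≤ ∑ A ∈ F, (if A ⊆ s then 1 else 0) := Finset.sum_nonneg fun _ _ => hnn _
      linarith
    · have hz : A ∈ F := by
        simp only [hF, Finset.mem_filter, Finset.mem_powersetCard]
        exact ⟨⟨hA.1, hAc⟩, hd⟩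
      have h2 := Finset.single_le_sum (f := fun A : Finset α =>
        if A ⊆ s then (1 : ℝ) else 0) (fun _ _ => hnn _) hz
      rw [if_pos hA.2] at h2
      have h3 : (0 : ℝ) ≤ ∑ z ∈ G, (if z.1 ∪ z.2 ⊆ s then 1 else 0) :=
        Finset.sum_nonneg fun _ _ => hnn _
      linarith
  have hFc : (F.card : ℝ) ≤ (t ∩ t').card * (K : ℝ) ^ q := by
    have := card_powersetCard_meets_le q t t'
    rw [ht] at this
    exact_mod_cast this
  have hGc : (G.card : ℝ) ≤ ((K : ℝ) ^ (q + 1)) ^ 2 := by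
    have : G.card ≤ (K ^ (q + 1)) ^ 2 := by
      refine (Finset.card_filter_le _ _).trans ?_
      rw [Finset.card_product, Finset.card_powersetCard, Finset.card_powersetCard, ht, ht', sq]
      exact Nat.mul_le_mul (Nat.choose_le_pow _ _) (Nat.choose_le_pow _ _)
    exact_mod_cast this
  have hK0 : (0 : ℝ) < K := by exact_mod_cast hK1
  calc _ ≤ ∑ s, ringWeight α K s * (∑ A ∈ F, (if A ⊆ s then (1 : ℝ) else 0)
          + ∑ z ∈ G, (if z.1 ∪ z.2 ⊆ s then 1 else 0)) := by
        gcongr with s _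
        · exact ringWeight_nonneg K s
        · exact h1 s
    _ = ∑ A ∈ F, ∑ s, ringWeight α K s * (if A ⊆ s then (1 : ℝ) else 0)
        + ∑ z ∈ G, ∑ s, ringWeight α K s * (if z.1 ∪ z.2 ⊆ s then (1 : ℝ) else 0) := by
        simp_rw [mul_add, Finset.sum_add_distrib, Finset.mul_sum]
        rw [Finset.sum_comm]
        congr 1
        rw [Finset.sum_comm]
    _ ≤ ∑ A ∈ F, ((K : ℝ) / N) ^ (q + 1) + ∑ z ∈ G, ((K : ℝ) / N) ^ (2 * (q + 1)) := by
        gcongr with A hA z hz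
        · have hc : A.card = q + 1 := by
            simp only [hF, Finset.mem_filter, Finset.mem_powersetCard] at hA
            exact hA.1.2
          rw [← hc]; exact sum_ringWeight_superset_le hK A
        · have hc : (z.1 ∪ z.2).card = 2 * (q + 1) := by
            simp only [hG, Finset.mem_filter, Finset.mem_product, Finset.mem_powersetCard] at hz
            rw [Finset.card_union_of_disjoint hz.2, hz.1.1.2, hz.1.2.2]; ring
          rw [← hc]; exact sum_ringWeight_superset_le hK _
    _ ≤ ((t ∩ t').card * (K : ℝ) ^ q) * ((K : ℝ) / N) ^ (q + 1)
        + ((K : ℝ) ^ (q + 1)) ^ 2 * ((K : ℝ) / N) ^ (2 * (q + 1)) := by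
        rw [Finset.sum_const, Finset.sum_const, nsmul_eq_mul, nsmul_eq_mul]
        gcongr
    _ = _ := by
        have e1 : (K : ℝ) ^ q = (K : ℝ) ^ (q + 1) / K := by rw [pow_succ]; field_simp
        rw [e1, ← pow_mul, ← pow_mul, mul_comm 2 (q + 1), pow_mul, pow_mul,
          pow_mul]
        have e2 : (K : ℝ) ^ 2 / N = K * (K / N) := by ring
        rw [e2, mul_pow]
        ring

lemma card_filter_card_inter {K : ℕ} (t : Finset α) (ht : t.card = K) (u : ℕ) :
    #{s : Finset α | s.card = K ∧ (t ∩ s).card = u}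
      = K.choose u * (Fintype.card α - K).choose (K - u) := by
  by_cases hu : u ≤ K
  swap
  · rw [Nat.choose_eq_zero_of_lt (by omega), zero_mul, Finset.card_eq_zero,
      Finset.filter_eq_empty_iff]
    rintro s - ⟨h1, h2⟩
    have := Finset.card_le_card (Finset.inter_subset_left (s₁ := t) (s₂ := s))
    omega
  have : (Fintype.card α - K) = tᶜ.card := by rw [Finset.card_compl, ht]
  rw [this, ← ht, ← Finset.card_powersetCard, ← Finset.card_powersetCard, ← Finset.card_product]
  refine Finset.card_bij' (fun s _ => (t ∩ s, s \ t)) (fun z _ => z.1 ∪ z.2) ?_ ?_ ?_ ?_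
  · intro s hs
    simp only [Finset.mem_filter, Finset.mem_univ, true_and] at hs
    simp only [Finset.mem_product, Finset.mem_powersetCard]
    refine ⟨⟨Finset.inter_subset_left, hs.2⟩, fun x hx => by simp at hx ⊢; exact hx.2, ?_⟩
    rw [Finset.card_sdiff, hs.1, hs.2]
  · rintro ⟨a, b⟩ hz
    simp only [Finset.mem_product, Finset.mem_powersetCard] at hz
    obtain ⟨⟨h1, h2⟩, h3, h4⟩ := hz
    have hd : Disjoint t b := by
      rw [Finset.disjoint_right]; intro x hx; simpa using h3 hx
    simp only [Finset.mem_filter, Finset.mem_univ, true_and]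
    constructor
    · rw [Finset.card_union_of_disjoint (hd.mono_left h1), h2, h4]; omega
    · rw [Finset.inter_union_distrib_left, Finset.inter_eq_right.2 h1,
        Finset.disjoint_iff_inter_eq_empty.1 hd, Finset.union_empty, h2]
  · intro s _
    ext x; simp; tauto
  · rintro ⟨a, b⟩ hz
    simp only [Finset.mem_product, Finset.mem_powersetCard] at hz
    obtain ⟨⟨h1, h2⟩, h3, h4⟩ := hz
    have hb : ∀ x ∈ b, x ∉ t := fun x hx => by simpa using h3 hx
    ext x
    · simp only [Finset.mem_inter, Finset.mem_union]
      have := @h1 x; have := hb x; tauto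
    · simp only [Finset.mem_sdiff, Finset.mem_union]
      have := @h1 x; have := hb x; tauto

/-- `psq` is the probability that a random ring shares at least `q` keys with a fixed one. -/
lemma sum_ringWeight_share {K : ℕ} (hK : K ≤ Fintype.card α) (q : ℕ) (t : Finset α)
    (ht : t.card = K) :
    ∑ s, ringWeight α K s * (if q ≤ (t ∩ s).card then 1 else 0)
      = psq q K (Fintype.card α) := by
  have h1 : ∀ s : Finset α, (if q ≤ (t ∩ s).card then (1 : ℝ) else 0)
      = 1 - ∑ u ∈ Finset.range q, (if (t ∩ s).card = u then 1 else 0) := by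
    intro s
    rw [Finset.sum_ite_eq]
    by_cases h : q ≤ (t ∩ s).card
    · simp [h, not_lt.2 h]
    · simp [h, not_le.1 h]
  simp_rw [h1, mul_sub, Finset.sum_sub_distrib, mul_one, sum_ringWeight hK, Finset.mul_sum]
  rw [Finset.sum_comm]
  unfold psq
  congr 1
  refine Finset.sum_congr rfl fun u _ => ?_
  rw [sum_ringWeight_ite, card_filter_card_inter t ht]
  push_cast
  rw [div_eq_mul_inv]

lemma psq_lower {q K N : ℕ} (hKq : 2 * q ≤ K) (hK1 : 1 ≤ K) (hKN : K ≤ N)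
    (hx : (K : ℝ) ^ 2 / N ≤ 1 / 4) :
    (1 / 2) * (1 / 2) ^ (2 * q) / (q.factorial : ℝ) * ((K : ℝ) ^ 2 / N) ^ q ≤ psq q K N := by
  have hK0 : (1 : ℝ) ≤ K := by exact_mod_cast hK1
  have hN0 : (0 : ℝ) < N := by exact_mod_cast hK1.trans hKN
  have hN4 : 4 * (K : ℝ) ^ 2 ≤ N := by
    rw [div_le_iff₀ hN0] at hx; linarith
  have hN4' : 4 * (K : ℝ) ≤ N := by nlinarith
  have hN4n : 4 * K ≤ N := by exact_mod_cast hN4'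
  obtain ⟨t, -, ht⟩ := Finset.exists_subset_card_eq (s := (Finset.univ : Finset (Fin N))) (n := K)
    (by simpa using hKN)
  have hKN' : K ≤ Fintype.card (Fin N) := by simpa using hKN
  have h1 := sum_ringWeight_share hKN' q t ht
  have h2 : (K.choose q * (N - K).choose (K - q) : ℝ) * ((N.choose K : ℝ))⁻¹ ≤ psq q K N := by
    have h3 := sum_ringWeight_ite K (fun s : Finset (Fin N) => (t ∩ s).card = q)
    rw [card_filter_card_inter t ht q] at h3
    simp only [Fintype.card_fin] at h1 h3
    push_cast at h3
    rw [← h1, ← h3]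
    refine Finset.sum_le_sum fun s _ => mul_le_mul_of_nonneg_left ?_ (ringWeight_nonneg K s)
    by_cases h : (t ∩ s).card = q
    · simp [h]
    · simp only [h, if_false]; split_ifs <;> norm_num
  refine le_trans ?_ h2
  set d := K - q with hd
  have hq' : q ≤ K := by omega
  have hdfN : ((N - q).choose d : ℝ) * d.factorial ≤ (N : ℝ) ^ d := by
    have : (N - q).choose d * d.factorial ≤ N ^ d := by
      rw [mul_comm, ← Nat.descFactorial_eq_factorial_mul_choose]
      exact (Nat.descFactorial_le_pow _ _).trans (Nat.pow_le_pow_left (Nat.sub_le _ _) _)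
    exact_mod_cast this
  have hdfK : (N - 2 * K : ℝ) ^ d ≤ ((N - K).choose d : ℝ) * d.factorial := by
    have : (N - 2 * K) ^ d ≤ (N - K).choose d * d.factorial := by
      rw [mul_comm ((N - K).choose d), ← Nat.descFactorial_eq_factorial_mul_choose]
      refine le_trans (Nat.pow_le_pow_left ?_ _) (Nat.pow_sub_le_descFactorial _ _)
      omega
    have h5 : ((N - 2 * K : ℕ) : ℝ) = N - 2 * K := by
      rw [Nat.cast_sub (by omega)]; push_cast; ring
    rw [← h5]
    exact_mod_cast this
  have hbern : (1 / 2 : ℝ) * (N : ℝ) ^ d ≤ (N - 2 * K : ℝ) ^ d := by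
    have h6 := one_add_mul_le_pow (a := -(2 * K / N : ℝ)) (by
      rw [neg_le_neg_iff, div_le_iff₀ hN0]; linarith) d
    have h7 : (d : ℝ) * (2 * K / N) ≤ 1 / 2 := by
      have : (d : ℝ) ≤ K := by exact_mod_cast Nat.sub_le _ _
      calc (d : ℝ) * (2 * K / N) ≤ K * (2 * K / N) := by gcongr
        _ = 2 * (K ^ 2 / N) := by ring
        _ ≤ 1 / 2 := by linarith
    have h8 : (N - 2 * K : ℝ) = N * (1 + -(2 * K / N)) := by field_simp; ring
    rw [h8, mul_pow, mul_comm]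
    gcongr
    linarith
  have hratio : (1 / 2 : ℝ) * (N - q).choose d ≤ (N - K).choose d := by
    have hf : (0 : ℝ) < d.factorial := by exact_mod_cast Nat.factorial_pos d
    have : (1 / 2 : ℝ) * ((N - q).choose d * d.factorial) ≤ (N - K).choose d * d.factorial := by
      linarith
    nlinarith
  have hCK : ((K : ℝ) / 2) ^ q ≤ K.choose q * q.factorial := by
    have h9 := Nat.pow_le_choose (α := ℝ) q K
    rw [div_le_iff₀ (by exact_mod_cast Nat.factorial_pos q)] at h9
    refine le_trans ?_ h9
    gcongr
    rw [Nat.cast_sub (by omega)]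
    have : (2 * q : ℝ) ≤ K := by exact_mod_cast hKq
    push_cast; linarith
  have hCN : (N.choose q : ℝ) * q.factorial ≤ (N : ℝ) ^ q := by
    have h9 := Nat.choose_le_pow_div (α := ℝ) q N
    rwa [le_div_iff₀ (by exact_mod_cast Nat.factorial_pos q)] at h9
  have hmul : (N.choose K : ℝ) * K.choose q = N.choose q * (N - q).choose d := by
    exact_mod_cast Nat.choose_mul hq'
  have hpNK : (0 : ℝ) < N.choose K := by exact_mod_cast Nat.choose_pos hKN
  have hpKq : (0 : ℝ) < K.choose q := by exact_mod_cast Nat.choose_pos hq'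
  have hpNq : (0 : ℝ) < N.choose q := by exact_mod_cast Nat.choose_pos (hq'.trans hKN)
  have hf : (0 : ℝ) < q.factorial := by exact_mod_cast Nat.factorial_pos q
  have hpd : (0 : ℝ) < (N - q).choose d := by
    exact_mod_cast Nat.choose_pos (by omega)
  have hsq : ((K : ℝ) / 2) ^ (2 * q) ≤ (K.choose q * q.factorial) ^ 2 := by
    rw [mul_comm 2 q, pow_mul]; gcongr
  rw [← div_eq_mul_inv, le_div_iff₀ hpNK]
  have e1 : (N.choose K : ℝ) = N.choose q * (N - q).choose d / K.choose q := by
    field_simp; linarith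
  calc (1 / 2 : ℝ) * (1 / 2) ^ (2 * q) / q.factorial * ((K : ℝ) ^ 2 / N) ^ q * N.choose K
      = (1 / 2) * ((K : ℝ) / 2) ^ (2 * q) / (q.factorial * N ^ q)
        * (N.choose q * (N - q).choose d / K.choose q) := by
        rw [e1, div_pow, div_pow, div_pow, one_pow, ← pow_mul]; field_simp
    _ ≤ (1 / 2) * (K.choose q * q.factorial) ^ 2 / (q.factorial * (N.choose q * q.factorial))
        * (N.choose q * (N - q).choose d / K.choose q) := by
        gcongr
    _ = K.choose q * ((1 / 2) * (N - q).choose d) := by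
        field_simp
    _ ≤ _ := by gcongr

end KeyRing

section Product

lemma sum_pi_prod {ι β : Type*} [Fintype ι] [DecidableEq ι] [Fintype β] (F : ι → β → ℝ) :
    ∑ S : ι → β, ∏ i, F i (S i) = ∏ i, ∑ b, F i b := by
  rw [Finset.prod_univ_sum, Fintype.piFinset_univ]

lemma sum_bool_channels {J E : Type*} [Fintype J] [Fintype E] [DecidableEq E] (e : J → E)
    (he : Function.Injective e) (p : ℝ) (φ : J → Bool → ℝ) :
    ∑ c : E → Bool, (∏ x, if c x then p else 1 - p) * ∏ j, φ j (c (e j))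
      = ∏ j, (p * φ j true + (1 - p) * φ j false) := by
  set ψ : E → Bool → ℝ := Function.extend e φ 1 with hψ
  have h1 : ∀ c : E → Bool, ∏ j, φ j (c (e j)) = ∏ x, ψ x (c x) := by
    intro c
    refine Fintype.prod_of_injective e he _ _ ?_ ?_
    · intro x hx
      rw [hψ, Function.extend_apply' _ _ _ (by simpa using hx)]; rfl
    · intro j
      rw [hψ, he.extend_apply]
  simp_rw [h1, ← Finset.prod_mul_distrib]
  rw [sum_pi_prod (fun x b => (if b = true then p else 1 - p) * ψ x b)]
  symm
  refine Fintype.prod_of_injective e he _ _ ?_ ?_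
  · intro x hx
    have : ψ x = 1 := by
      rw [hψ, Function.extend_apply' _ _ _ (by simpa using hx)]; rfl
    simp [this]
  · intro j
    have : ψ (e j) = φ j := by rw [hψ, he.extend_apply]
    simp [this]

variable {ι α : Type*} [Fintype ι] [DecidableEq ι] [Fintype α] [DecidableEq α]

lemma sum_pi_ringWeight {K : ℕ} (hK : K ≤ Fintype.card α) :
    ∑ S : ι → Finset α, ∏ i, ringWeight α K (S i) = 1 := by
  rw [sum_pi_prod (fun _ => ringWeight α K)]
  simp [sum_ringWeight hK]

lemma prod_ringWeight_nonneg (K : ℕ) (S : ι → Finset α) : 0 ≤ ∏ i, ringWeight α K (S i) :=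
  Finset.prod_nonneg fun _ _ => ringWeight_nonneg K _

lemma sum_pi_ringWeight_pair_le {K : ℕ} (hK : K ≤ Fintype.card α) {v v' : ι} (hv : v' ≠ v)
    (f : Finset α → Finset α → ℝ) (C : ℝ)
    (hf : ∀ t, t.card = K → ∑ s, ringWeight α K s * f s t ≤ C) :
    ∑ S : ι → Finset α, (∏ i, ringWeight α K (S i)) * f (S v) (S v') ≤ C := by
  rw [Fintype.sum_equiv (Equiv.funSplitAt v (Finset α)) _
    (fun z => ringWeight α K z.1 * (∏ i, ringWeight α K (z.2 i)) * f z.1 (z.2 ⟨v', hv⟩))]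
  swap
  · intro S
    have := Fintype.prod_eq_mul_prod_subtype_ne (fun i => ringWeight α K (S i)) v
    rw [this]
    rfl
  rw [Fintype.sum_prod_type, Finset.sum_comm]
  calc ∑ r : {j // j ≠ v} → Finset α, ∑ s, ringWeight α K s * (∏ i, ringWeight α K (r i))
          * f s (r ⟨v', hv⟩)
      ≤ ∑ r : {j // j ≠ v} → Finset α, (∏ i, ringWeight α K (r i)) * C := by
        refine Finset.sum_le_sum fun r _ => ?_
        by_cases hr : (r ⟨v', hv⟩).card = K
        · calc _ = (∏ i, ringWeight α K (r i)) * ∑ s, ringWeight α K s * f s (r ⟨v', hv⟩) := by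
                rw [Finset.mul_sum]; exact Finset.sum_congr rfl fun _ _ => by ring
            _ ≤ _ := mul_le_mul_of_nonneg_left (hf _ hr) (prod_ringWeight_nonneg K r)
        · have : ∏ i, ringWeight α K (r i) = 0 :=
            Finset.prod_eq_zero (Finset.mem_univ ⟨v', hv⟩) (by simp [ringWeight, hr])
          simp [this]
    _ = C := by
        rw [← Finset.sum_mul, sum_pi_ringWeight hK, one_mul]

/-- Independent random `K`-subsets are pairwise disjoint with probability close to one. -/
lemma sum_pi_ringWeight_disjoint_ge {K : ℕ} (hK : K ≤ Fintype.card α) :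
    1 - (Fintype.card ι : ℝ) ^ 2 * ((K : ℝ) ^ 2 / Fintype.card α)
      ≤ ∑ S : ι → Finset α, (∏ i, ringWeight α K (S i)) *
          (if ∀ v v', v ≠ v' → Disjoint (S v) (S v') then 1 else 0) := by
  have h1 : ∀ S : ι → Finset α,
      1 - ∑ z ∈ (Finset.univ : Finset ι).offDiag,
        (if Disjoint (S z.1) (S z.2) then (0 : ℝ) else 1)
      ≤ (if ∀ v v', v ≠ v' → Disjoint (S v) (S v') then 1 else 0) := by
    intro S
    have hnn : ∀ z ∈ (Finset.univ : Finset ι).offDiag,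
        0 ≤ (if Disjoint (S z.1) (S z.2) then (0 : ℝ) else 1) := by
      intro z _; split_ifs <;> norm_num
    split_ifs with h
    · linarith [Finset.sum_nonneg hnn]
    · push Not at h
      obtain ⟨v, v', hne, hd⟩ := h
      have := Finset.single_le_sum hnn (a := (v, v')) (by simp [hne])
      rw [if_neg hd] at this
      linarith
  calc _ ≤ 1 - ∑ z ∈ (Finset.univ : Finset ι).offDiag, ((K : ℝ) ^ 2 / Fintype.card α) := by
        rw [Finset.sum_const, nsmul_eq_mul]
        have : ((Finset.univ : Finset ι).offDiag.card : ℝ) ≤ (Fintype.card ι : ℝ) ^ 2 := by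
          have : (Finset.univ : Finset ι).offDiag.card ≤ (Fintype.card ι) ^ 2 := by
            rw [Finset.offDiag_card, Finset.card_univ, sq]; exact Nat.sub_le _ _
          exact_mod_cast this
        gcongr
    _ ≤ 1 - ∑ z ∈ (Finset.univ : Finset ι).offDiag,
          ∑ S : ι → Finset α, (∏ i, ringWeight α K (S i)) *
            (if Disjoint (S z.1) (S z.2) then (0 : ℝ) else 1) := by
        gcongr with z hz
        refine sum_pi_ringWeight_pair_le hK (Ne.symm (Finset.mem_offDiag.1 hz).2.2)
          (fun s t => if Disjoint s t then (0 : ℝ) else 1) _ fun t ht => ?_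
        exact sum_ringWeight_meets_le hK t ht
    _ = ∑ S : ι → Finset α, (∏ i, ringWeight α K (S i)) *
          (1 - ∑ z ∈ (Finset.univ : Finset ι).offDiag,
            (if Disjoint (S z.1) (S z.2) then (0 : ℝ) else 1)) := by
        simp_rw [mul_sub, Finset.sum_sub_distrib, mul_one, sum_pi_ringWeight hK, Finset.mul_sum]
        rw [Finset.sum_comm]
    _ ≤ _ := by
        gcongr with S _
        · exact prod_ringWeight_nonneg K S
        · exact h1 S

/-- Exponential moment of the total pairwise intersection size. -/
lemma sum_pi_ringWeight_exp_le {K : ℕ} (hK : K ≤ Fintype.card α) {θ : ℝ} (hθ : 0 ≤ θ) :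
    ∑ S : ι → Finset α, (∏ i, ringWeight α K (S i)) *
        Real.exp (θ * ∑ z ∈ (Finset.univ : Finset ι).offDiag, ((S z.1 ∩ S z.2).card : ℝ))
      ≤ 1 + (Fintype.card ι : ℝ) ^ 2 *
        (Real.exp ((Real.exp ((Fintype.card ι : ℝ) ^ 2 * θ) - 1) *
          ((K : ℝ) ^ 2 / Fintype.card α)) - 1) := by
  set N : ℝ := (Fintype.card ι : ℝ) ^ 2 with hN
  set x : ℝ := (K : ℝ) ^ 2 / Fintype.card α with hx
  have hN0 : 0 ≤ N := by positivity
  have hx0 : 0 ≤ x := by positivity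
  have hcard : ((Finset.univ : Finset ι).offDiag.card : ℝ) ≤ N := by
    have : (Finset.univ : Finset ι).offDiag.card ≤ (Fintype.card ι) ^ 2 := by
      rw [Finset.offDiag_card, Finset.card_univ, sq]; exact Nat.sub_le _ _
    rw [hN]; exact_mod_cast this
  have h1 : ∀ S : ι → Finset α,
      Real.exp (θ * ∑ z ∈ (Finset.univ : Finset ι).offDiag, ((S z.1 ∩ S z.2).card : ℝ))
      ≤ 1 + ∑ z ∈ (Finset.univ : Finset ι).offDiag,
          (Real.exp (N * θ * ((S z.1 ∩ S z.2).card : ℝ)) - 1) := by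
    intro S
    have hnn : ∀ z ∈ (Finset.univ : Finset ι).offDiag,
        0 ≤ Real.exp (N * θ * ((S z.1 ∩ S z.2).card : ℝ)) - 1 := by
      intro z _
      rw [sub_nonneg]; apply Real.one_le_exp; positivity
    rcases (Finset.univ : Finset ι).offDiag.eq_empty_or_nonempty with he | hne
    · simp [he]
    obtain ⟨z₀, hz₀, hmax⟩ := Finset.exists_max_image _ (fun z => (S z.1 ∩ S z.2).card) hne
    have h2 : ∑ z ∈ (Finset.univ : Finset ι).offDiag, ((S z.1 ∩ S z.2).card : ℝ)
        ≤ N * (S z₀.1 ∩ S z₀.2).card := by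
      calc _ ≤ ∑ z ∈ (Finset.univ : Finset ι).offDiag, ((S z₀.1 ∩ S z₀.2).card : ℝ) :=
            Finset.sum_le_sum fun z hz => by exact_mod_cast hmax z hz
        _ ≤ _ := by rw [Finset.sum_const, nsmul_eq_mul]; gcongr
    have h3 := Finset.single_le_sum hnn hz₀
    calc _ ≤ Real.exp (N * θ * ((S z₀.1 ∩ S z₀.2).card : ℝ)) := by
          apply Real.exp_le_exp.2
          calc _ ≤ θ * (N * (S z₀.1 ∩ S z₀.2).card) := by gcongr
            _ = _ := by ring
      _ ≤ _ := by linarith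
  have hy : (0 : ℝ) ≤ Real.exp (N * θ) - 1 := by
    rw [sub_nonneg]; apply Real.one_le_exp; positivity
  calc _ ≤ ∑ S : ι → Finset α, (∏ i, ringWeight α K (S i)) *
          (1 + ∑ z ∈ (Finset.univ : Finset ι).offDiag,
            (Real.exp (N * θ * ((S z.1 ∩ S z.2).card : ℝ)) - 1)) := by
        gcongr with S _
        · exact prod_ringWeight_nonneg K S
        · exact h1 S
    _ = 1 + ∑ z ∈ (Finset.univ : Finset ι).offDiag,
          ∑ S : ι → Finset α, (∏ i, ringWeight α K (S i)) *
            (Real.exp (N * θ * ((S z.1 ∩ S z.2).card : ℝ)) - 1) := by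
        simp_rw [mul_add, Finset.sum_add_distrib, mul_one, sum_pi_ringWeight hK, Finset.mul_sum]
        rw [Finset.sum_comm]
    _ ≤ 1 + ∑ z ∈ (Finset.univ : Finset ι).offDiag, (Real.exp ((Real.exp (N * θ) - 1) * x) - 1) := by
        gcongr with z hz
        refine sum_pi_ringWeight_pair_le hK (Ne.symm (Finset.mem_offDiag.1 hz).2.2)
          (fun s t => Real.exp (N * θ * ((s ∩ t).card : ℝ)) - 1) _ fun t ht => ?_
        simp_rw [mul_sub, Finset.sum_sub_distrib, mul_one, sum_ringWeight hK]
        gcongr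
        refine le_trans (le_of_eq ?_) (sum_ringWeight_pow_inter_le hK t ht hy)
        refine Finset.sum_congr rfl fun s _ => ?_
        rw [add_sub_cancel, ← Real.exp_nat_mul]
        congr 2; ring
    _ ≤ _ := by
        rw [Finset.sum_const, nsmul_eq_mul]
        gcongr
        rw [sub_nonneg]; apply Real.one_le_exp; positivity

end Product

section Model

lemma weight_eq (n K P : ℕ) (p : ℝ) (ω : Config n P) :
    weight n K P p ω = (∏ i, ringWeight (Fin P) K (ω.1 i)) *
      ∏ e : Sym2 (Fin n), if ω.2 e then p else 1 - p := by
  simp [weight, ringWeight]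

/-- Whether two vertices are adjacent, as a Boolean (for distinct vertices). -/
def adjBool (q n P : ℕ) (ω : Config n P) (i j : Fin n) : Bool :=
  decide (q ≤ (ω.1 i ∩ ω.1 j).card) && ω.2 s(i, j)

/-- Expectation of a product of functions of the edges between `V` and its complement,
obtained by conditioning on the key rings of the vertices in `V`. -/
lemma sum_weight_prod (q n K P : ℕ) (p : ℝ) (V : Finset (Fin n))
    (H : ({v // v ∈ V} → Finset (Fin P)) → ℝ) (φ : {v // v ∈ V} → {w // w ∉ V} → Bool → ℝ) :
    ∑ ω : Config n P, weight n K P p ω * (H (fun v => ω.1 v) *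
        ∏ w : {w // w ∉ V}, ∏ v : {v // v ∈ V}, φ v w (adjBool q n P ω v w))
      = ∑ S : {v // v ∈ V} → Finset (Fin P), (∏ v, ringWeight (Fin P) K (S v)) *
        (H S * ∏ w : {w // w ∉ V}, ∑ s, ringWeight (Fin P) K s *
          ∏ v : {v // v ∈ V}, (if q ≤ (S v ∩ s).card
            then p * φ v w true + (1 - p) * φ v w false else φ v w false)) := by
  rw [Fintype.sum_prod_type]
  set e : {w // w ∉ V} × {v // v ∈ V} → Sym2 (Fin n) := fun z => s(z.2.1, z.1.1) with he
  have hinj : Function.Injective e := by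
    rintro ⟨⟨w, hw⟩, ⟨v, hv⟩⟩ ⟨⟨w', hw'⟩, ⟨v', hv'⟩⟩ h
    simp only [he, Sym2.eq_iff] at h
    rcases h with ⟨h1, h2⟩ | ⟨h1, h2⟩
    · subst h1; subst h2; rfl
    · subst h1; exact absurd hv hw'
  have h1 : ∀ S : Fin n → Finset (Fin P),
      ∑ c : Sym2 (Fin n) → Bool, weight n K P p (S, c) * (H (fun v => S v) *
        ∏ w : {w // w ∉ V}, ∏ v : {v // v ∈ V}, φ v w (adjBool q n P (S, c) v w))
      = (∏ i, ringWeight (Fin P) K (S i)) * (H (fun v => S v) *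
        ∏ w : {w // w ∉ V}, ∏ v : {v // v ∈ V}, (if q ≤ (S v ∩ S w).card
            then p * φ v w true + (1 - p) * φ v w false else φ v w false)) := by
    intro S
    have h2 := sum_bool_channels e hinj p
      (fun z b => φ z.2 z.1 (decide (q ≤ (S z.2 ∩ S z.1).card) && b))
    rw [Fintype.prod_prod_type] at h2
    calc _ = (∏ i, ringWeight (Fin P) K (S i)) * (H (fun v => S v) *
          ∑ c : Sym2 (Fin n) → Bool, (∏ x, if c x then p else 1 - p) *
            ∏ z : {w // w ∉ V} × {v // v ∈ V},
              φ z.2 z.1 (decide (q ≤ (S z.2 ∩ S z.1).card) && c (e z))) := by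
          simp_rw [Finset.mul_sum]
          refine Finset.sum_congr rfl fun c _ => ?_
          rw [weight_eq, Fintype.prod_prod_type]
          simp only [adjBool, he]
          ring
      _ = _ := by
          rw [h2]
          congr 2
          refine Finset.prod_congr rfl fun w _ => Finset.prod_congr rfl fun v _ => ?_
          split_ifs with h
          · simp [h]
          · simp [h]; ring
  simp_rw [h1]
  rw [Fintype.sum_equiv (Equiv.piEquivPiSubtypeProd (fun v => v ∈ V) (fun _ => Finset (Fin P))) _
    (fun z => ((∏ v, ringWeight (Fin P) K (z.1 v)) * ∏ w, ringWeight (Fin P) K (z.2 w)) *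
      (H z.1 * ∏ w : {w // w ∉ V}, ∏ v : {v // v ∈ V}, (if q ≤ (z.1 v ∩ z.2 w).card
            then p * φ v w true + (1 - p) * φ v w false else φ v w false)))]
  swap
  · intro S
    have h3 : ∏ i, ringWeight (Fin P) K (S i) = (∏ v : {v // v ∈ V}, ringWeight (Fin P) K (S v)) *
        ∏ w : {w // w ∉ V}, ringWeight (Fin P) K (S w) := by
      convert (Fintype.prod_subtype_mul_prod_subtype (fun v => v ∈ V)
        fun v => ringWeight (Fin P) K (S v)).symm
    rw [h3]
    rfl
  rw [Fintype.sum_prod_type]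
  refine Finset.sum_congr rfl fun S _ => ?_
  rw [← sum_pi_prod (fun (w : {w // w ∉ V}) s => ringWeight (Fin P) K s *
    ∏ v : {v // v ∈ V}, (if q ≤ (S v ∩ s).card
            then p * φ v w true + (1 - p) * φ v w false else φ v w false))]
  simp_rw [Finset.mul_sum, Finset.prod_mul_distrib]
  refine Finset.sum_congr rfl fun R _ => ?_
  ring

end Model

section Fibers

variable {ι J : Type*} [Fintype ι] [DecidableEq ι] [Fintype J] [DecidableEq J]

/-- The elements that a partial map sends to `v`. -/
def fiber (f : J → Option ι) (v : ι) : Finset J := {w | f w = some v}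

lemma mem_fiber {f : J → Option ι} {v : ι} {w : J} : w ∈ fiber f v ↔ f w = some v := by
  simp [fiber]

lemma prod_eq_prod_fiber (f : J → Option ι) (a b : ℝ) :
    ∏ w, (if f w = none then a else b)
      = a ^ #{w | f w = none} * ∏ v, b ^ (fiber f v).card := by
  have h : ∏ w, (if f w = none then a else b)
      = ∏ o : Option ι, ∏ w with f w = o, (if o = none then a else b) := by
    rw [← Finset.prod_fiberwise' (s := Finset.univ) (g := f)
      (f := fun o => if o = none then a else b)]
  rw [h, Fintype.prod_option]
  simp [fiber]

lemma card_eq_sum_fiber (f : J → Option ι) :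
    Fintype.card J = #{w | f w = none} + ∑ v, (fiber f v).card := by
  have h := Finset.card_eq_sum_card_fiberwise (f := f) (s := Finset.univ)
    (t := Finset.univ) (fun _ _ => by simp)
  rw [Fintype.sum_option, Finset.card_univ] at h
  exact h

lemma fiber_injective : Function.Injective (fiber (ι := ι) (J := J)) := by
  intro f g h
  funext w
  ext v
  have := congrFun h v
  rw [← mem_fiber, this, mem_fiber]

lemma sum_card_le_pow_le (j : ℕ) {e : ℝ} (he : 0 ≤ e) {n : ℕ} (hn : Fintype.card J ≤ n) :
    ∑ W : Finset J, (if W.card ≤ j then e ^ W.card else 0)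
      ≤ ∑ i ∈ Finset.range (j + 1), ((n : ℝ) * e) ^ i / i.factorial := by
  have h1 : ∀ W : Finset J, (if W.card ≤ j then e ^ W.card else 0)
      = ∑ i ∈ Finset.range (j + 1), (if W.card = i then e ^ i else 0) := by
    intro W
    rw [Finset.sum_ite_eq]
    simp
  simp_rw [h1]
  rw [Finset.sum_comm]
  refine Finset.sum_le_sum fun i _ => ?_
  rw [← Finset.sum_filter, Finset.sum_const, nsmul_eq_mul]
  have h2 : #{W : Finset J | W.card = i} = (Fintype.card J).choose i := by
    rw [← Finset.card_univ (α := J), ← Finset.card_powersetCard]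
    congr 1; ext s; simp [Finset.mem_powersetCard]
  rw [h2, mul_pow, mul_div_right_comm]
  gcongr
  refine (Nat.choose_le_pow_div (α := ℝ) _ _).trans ?_
  gcongr

lemma sum_fiber_le (j : ℕ) {e : ℝ} (he : 0 ≤ e) {n : ℕ} (hn : Fintype.card J ≤ n) :
    ∑ f : J → Option ι with ∀ v, (fiber f v).card ≤ j, ∏ v, e ^ (fiber f v).card
      ≤ (∑ i ∈ Finset.range (j + 1), ((n : ℝ) * e) ^ i / i.factorial) ^ Fintype.card ι := by
  set g : (ι → Finset J) → ℝ := fun W => ∏ v, (if (W v).card ≤ j then e ^ (W v).card else 0)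
    with hg
  have hg0 : ∀ W, 0 ≤ g W := fun W => Finset.prod_nonneg fun v _ => by split_ifs <;> positivity
  calc _ = ∑ f : J → Option ι with ∀ v, (fiber f v).card ≤ j, g (fiber f) := by
        refine Finset.sum_congr rfl fun f hf => ?_
        rw [Finset.mem_filter] at hf
        exact Finset.prod_congr rfl fun v _ => by rw [if_pos (hf.2 v)]
    _ ≤ ∑ f : J → Option ι, g (fiber f) :=
        Finset.sum_le_sum_of_subset_of_nonneg (Finset.filter_subset _ _) fun _ _ _ => hg0 _
    _ = ∑ W ∈ Finset.univ.image (fiber (ι := ι) (J := J)), g W := by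
        rw [Finset.sum_image fun _ _ _ _ h => fiber_injective h]
    _ ≤ ∑ W, g W :=
        Finset.sum_le_sum_of_subset_of_nonneg (Finset.subset_univ _) fun _ _ _ => hg0 _
    _ = ∏ v : ι, ∑ W : Finset J, (if W.card ≤ j then e ^ W.card else 0) := by
        rw [hg, sum_pi_prod (fun _ (W : Finset J) => if W.card ≤ j then e ^ W.card else 0)]
    _ ≤ ∏ v : ι, (∑ i ∈ Finset.range (j + 1), ((n : ℝ) * e) ^ i / i.factorial) :=
        Finset.prod_le_prod
          (fun _ _ => Finset.sum_nonneg fun _ _ => by split_ifs <;> positivity)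
          fun _ _ => sum_card_le_pow_le j he hn
    _ = _ := by rw [Finset.prod_const, Finset.card_univ]

lemma card_fiber_eq_ge {j : ℕ} (hj : j ≤ Fintype.card J) :
    (1 - (Fintype.card ι : ℝ) ^ 2 * ((j : ℝ) ^ 2 / Fintype.card J)) *
        ((Fintype.card J).choose j : ℝ) ^ Fintype.card ι
      ≤ (#{f : J → Option ι | ∀ v, (fiber f v).card = j} : ℝ) := by
  have hpos : (0 : ℝ) < ((Fintype.card J).choose j : ℝ) := by exact_mod_cast Nat.choose_pos hj
  set D : Finset (ι → Finset J) :=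
    {W | (∀ v, (W v).card = j) ∧ ∀ v v', v ≠ v' → Disjoint (W v) (W v')} with hD
  have h1 : D.card ≤ #{f : J → Option ι | ∀ v, (fiber f v).card = j} := by
    refine Finset.card_le_card_of_surjOn fiber ?_
    intro W hW
    simp only [hD, Finset.coe_filter, Finset.mem_univ, true_and, Set.mem_ofPred_eq] at hW
    classical
    let f : J → Option ι := fun w => if h : ∃ v, w ∈ W v then some h.choose else none
    have hf : fiber f = W := by
      funext v
      ext w
      rw [mem_fiber]
      by_cases h : ∃ v, w ∈ W v
      · simp only [f, dif_pos h, Option.some.injEq]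
        constructor
        · intro h'; rw [← h']; exact h.choose_spec
        · intro h'
          by_contra hne
          exact Finset.disjoint_left.1 (hW.2 _ _ hne) h.choose_spec h'
      · simp only [f, dif_neg h]
        push Not at h
        simp [h v]
    refine ⟨f, ?_, hf⟩
    simp [hf, hW.1]
  have h2 := sum_pi_ringWeight_disjoint_ge (ι := ι) (α := J) hj
  have h3 : ∑ S : ι → Finset J, (∏ i, ringWeight J j (S i)) *
          (if ∀ v v', v ≠ v' → Disjoint (S v) (S v') then 1 else 0)
      = (D.card : ℝ) * ((((Fintype.card J).choose j : ℝ))⁻¹) ^ Fintype.card ι := by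
    rw [hD, ← nsmul_eq_mul, ← Finset.sum_const, Finset.sum_filter]
    refine Finset.sum_congr rfl fun S _ => ?_
    by_cases hc : ∀ v, (S v).card = j
    · simp [ringWeight, hc]
    · have : ∏ i, ringWeight J j (S i) = 0 := by
        push Not at hc
        obtain ⟨v, hv⟩ := hc
        exact Finset.prod_eq_zero (Finset.mem_univ v) (by simp [ringWeight, hv])
      simp [this, hc]
  rw [h3, inv_pow, ← div_eq_mul_inv, le_div_iff₀ (by positivity)] at h2
  exact h2.trans (by exact_mod_cast h1)

end Fibers

section Bonferroni

variable {ι : Type*} [DecidableEq ι]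

lemma one_sub_sum_le_prod (s : Finset ι) (a : ι → ℝ) (h0 : ∀ i ∈ s, 0 ≤ a i)
    (h1 : ∀ i ∈ s, a i ≤ 1) : 1 - ∑ i ∈ s, a i ≤ ∏ i ∈ s, (1 - a i) := by
  induction s using Finset.induction_on with
  | empty => simp
  | insert i s hi ih =>
    rw [Finset.sum_insert hi, Finset.prod_insert hi]
    have h2 := ih (fun k hk => h0 k (Finset.mem_insert_of_mem hk))
      (fun k hk => h1 k (Finset.mem_insert_of_mem hk))
    have h3 : 0 ≤ ∑ k ∈ s, a k := Finset.sum_nonneg fun k hk => h0 k (Finset.mem_insert_of_mem hk)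
    have h4 := h0 i (Finset.mem_insert_self _ _)
    have h5 := h1 i (Finset.mem_insert_self _ _)
    nlinarith

lemma prod_one_sub_le (s : Finset ι) (a : ι → ℝ) (h0 : ∀ i ∈ s, 0 ≤ a i)
    (h1 : ∀ i ∈ s, a i ≤ 1) :
    ∏ i ∈ s, (1 - a i) ≤ 1 - ∑ i ∈ s, a i + ∑ z ∈ s.offDiag, a z.1 * a z.2 := by
  induction s using Finset.induction_on with
  | empty => simp
  | insert i s hi ih =>
    have h2 := ih (fun k hk => h0 k (Finset.mem_insert_of_mem hk))
      (fun k hk => h1 k (Finset.mem_insert_of_mem hk))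
    have h3 : 0 ≤ ∑ k ∈ s, a k := Finset.sum_nonneg fun k hk => h0 k (Finset.mem_insert_of_mem hk)
    have h4 := h0 i (Finset.mem_insert_self _ _)
    have h5 := h1 i (Finset.mem_insert_self _ _)
    have h6 : 0 ≤ ∑ z ∈ s.offDiag, a z.1 * a z.2 := Finset.sum_nonneg fun z hz => by
      rw [Finset.mem_offDiag] at hz
      exact mul_nonneg (h0 _ (Finset.mem_insert_of_mem hz.1))
        (h0 _ (Finset.mem_insert_of_mem hz.2.1))
    have h7 : ∑ z ∈ s.offDiag, a z.1 * a z.2 + a i * ∑ k ∈ s, a k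
        ≤ ∑ z ∈ (insert i s).offDiag, a z.1 * a z.2 := by
      have hsub : s.offDiag ∪ s.image (fun k => (i, k)) ⊆ (insert i s).offDiag := by
        intro z hz
        rw [Finset.mem_union, Finset.mem_offDiag, Finset.mem_image] at hz
        rw [Finset.mem_offDiag, Finset.mem_insert, Finset.mem_insert]
        rcases hz with hz | ⟨k, hk, rfl⟩
        · exact ⟨Or.inr hz.1, Or.inr hz.2.1, hz.2.2⟩
        · exact ⟨Or.inl rfl, Or.inr hk, fun h => hi (by simp only at h; rwa [h])⟩
      have hdis : Disjoint s.offDiag (s.image (fun k => (i, k))) := by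
        rw [Finset.disjoint_right]
        intro z hz hz'
        obtain ⟨k, hk, rfl⟩ := Finset.mem_image.1 hz
        exact hi (Finset.mem_offDiag.1 hz').1
      refine le_trans (le_of_eq ?_) (Finset.sum_le_sum_of_subset_of_nonneg hsub ?_)
      · rw [Finset.sum_union hdis, Finset.sum_image fun _ _ _ _ h => (Prod.ext_iff.1 h).2,
          Finset.mul_sum]
      · intro z hz _
        rw [Finset.mem_offDiag] at hz
        exact mul_nonneg (h0 _ hz.1) (h0 _ hz.2.1)
    rw [Finset.sum_insert hi, Finset.prod_insert hi]
    nlinarith [mul_nonneg h4 h6, mul_le_mul_of_nonneg_left h2 (sub_nonneg.2 h5)]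

end Bonferroni

section EdgePatterns

variable {ι : Type*} [Fintype ι] [DecidableEq ι]

/-- Test function of an edge state that forces an edge to the label `o` of a vertex, or forbids
every edge if the vertex has no label. -/
def forcedEdge (o : Option ι) (v : ι) (b : Bool) : ℝ :=
  if (o = none → b = false) ∧ (o = some v → b = true) then 1 else 0

/-- Test function of an edge state that prescribes an edge exactly to the label `o`. -/
def exactEdge (o : Option ι) (v : ι) (b : Bool) : ℝ :=
  if (o = some v ↔ b = true) then 1 else 0

variable {α : Type*} [Fintype α] [DecidableEq α]

/-- The indicator that two key rings share at least `q` keys. -/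
def shareInd (q : ℕ) (t s : Finset α) : ℝ := if q ≤ (t ∩ s).card then 1 else 0

lemma shareInd_nonneg (q : ℕ) (t s : Finset α) : 0 ≤ shareInd q t s := by
  unfold shareInd; split_ifs <;> norm_num

lemma shareInd_le_one (q : ℕ) (t s : Finset α) : shareInd q t s ≤ 1 := by
  unfold shareInd; split_ifs <;> norm_num

/-- Probability that a fresh vertex is adjacent to none of the vertices with rings `S`. -/
noncomputable def isolatedProb (q K : ℕ) (p : ℝ) (S : ι → Finset α) : ℝ :=
  ∑ s, ringWeight α K s * ∏ v, (1 - p * shareInd q (S v) s)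

variable {q K : ℕ} {p : ℝ} {S : ι → Finset α}

lemma sum_forcedEdge_none :
    ∑ s, ringWeight α K s * ∏ v : ι, (if q ≤ (S v ∩ s).card
        then p * forcedEdge none v true + (1 - p) * forcedEdge none v false
        else forcedEdge none v false) = isolatedProb q K p S := by
  refine Finset.sum_congr rfl fun s _ => ?_
  congr 1
  refine Finset.prod_congr rfl fun v _ => ?_
  by_cases h : q ≤ (S v ∩ s).card <;> simp [forcedEdge, shareInd, h]

lemma sum_exactEdge_none :
    ∑ s, ringWeight α K s * ∏ v : ι, (if q ≤ (S v ∩ s).card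
        then p * exactEdge none v true + (1 - p) * exactEdge none v false
        else exactEdge none v false) = isolatedProb q K p S := by
  refine Finset.sum_congr rfl fun s _ => ?_
  congr 1
  refine Finset.prod_congr rfl fun v _ => ?_
  by_cases h : q ≤ (S v ∩ s).card <;> simp [exactEdge, shareInd, h]

lemma sum_shareInd (hK : K ≤ Fintype.card α) {t : Finset α} (ht : t.card = K) :
    ∑ s, ringWeight α K s * (p * shareInd q t s) = peq q K (Fintype.card α) p := by
  unfold peq
  rw [← sum_ringWeight_share hK q t ht, Finset.mul_sum]
  exact Finset.sum_congr rfl fun s _ => by unfold shareInd; ring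

lemma sum_forcedEdge_some (hK : K ≤ Fintype.card α) (hS : ∀ v, (S v).card = K) (v₀ : ι) :
    ∑ s, ringWeight α K s * ∏ v : ι, (if q ≤ (S v ∩ s).card
        then p * forcedEdge (some v₀) v true + (1 - p) * forcedEdge (some v₀) v false
        else forcedEdge (some v₀) v false) = peq q K (Fintype.card α) p := by
  rw [← sum_shareInd hK (hS v₀)]
  refine Finset.sum_congr rfl fun s _ => ?_
  congr 1
  have : ∀ v, (if q ≤ (S v ∩ s).card
        then p * forcedEdge (some v₀) v true + (1 - p) * forcedEdge (some v₀) v false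
        else forcedEdge (some v₀) v false)
      = if v₀ = v then p * shareInd q (S v) s else 1 := by
    intro v
    by_cases h : q ≤ (S v ∩ s).card <;> by_cases h' : v₀ = v <;>
      simp [forcedEdge, shareInd, h, h']
  simp_rw [this]
  rw [Finset.prod_ite_eq]
  simp

lemma sum_shareInd_both_le (hK1 : 1 ≤ K) (hK : K ≤ Fintype.card α) (hq : 1 ≤ q)
    {t t' : Finset α} (ht : t.card = K) (ht' : t'.card = K) :
    ∑ s, ringWeight α K s * ((p * shareInd q t s) * (p * shareInd q t' s))
      ≤ p ^ 2 * (((t ∩ t').card / (K : ℝ)) * ((K : ℝ) ^ 2 / Fintype.card α) ^ q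
        + (((K : ℝ) ^ 2 / Fintype.card α) ^ q) ^ 2) := by
  obtain ⟨r, rfl⟩ : ∃ r, q = r + 1 := ⟨q - 1, by omega⟩
  have h := sum_ringWeight_both_le hK1 hK r t t' ht ht'
  refine le_trans (le_of_eq ?_) (mul_le_mul_of_nonneg_left h (sq_nonneg p))
  rw [Finset.mul_sum]
  refine Finset.sum_congr rfl fun s _ => ?_
  unfold shareInd
  by_cases h1 : r + 1 ≤ (t ∩ s).card <;> by_cases h2 : r + 1 ≤ (t' ∩ s).card <;>
    simp only [h1, h2, if_true, if_false, and_true, and_false] <;> ring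

lemma isolatedProb_nonneg (hp0 : 0 ≤ p) (hp1 : p ≤ 1) : 0 ≤ isolatedProb q K p S :=
  Finset.sum_nonneg fun s _ => mul_nonneg (ringWeight_nonneg K s) <|
    Finset.prod_nonneg fun v _ => by
      nlinarith [shareInd_nonneg q (S v) s, shareInd_le_one q (S v) s]

lemma isolatedProb_ge (hp0 : 0 ≤ p) (hp1 : p ≤ 1) (hK : K ≤ Fintype.card α)
    (hS : ∀ v, (S v).card = K) :
    1 - Fintype.card ι * peq q K (Fintype.card α) p ≤ isolatedProb q K p S := by
  calc 1 - Fintype.card ι * peq q K (Fintype.card α) p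
      = ∑ s, ringWeight α K s * (1 - ∑ v, p * shareInd q (S v) s) := by
        simp_rw [mul_sub, Finset.sum_sub_distrib, mul_one, sum_ringWeight hK, Finset.mul_sum]
        rw [Finset.sum_comm]
        simp_rw [sum_shareInd hK (hS _)]
        simp
    _ ≤ _ := by
        unfold isolatedProb
        gcongr with s _
        · exact ringWeight_nonneg K s
        · refine one_sub_sum_le_prod _ _ (fun v _ => mul_nonneg hp0 (shareInd_nonneg _ _ _))
            fun v _ => mul_le_one₀ hp1 (shareInd_nonneg _ _ _) (shareInd_le_one _ _ _)

lemma isolatedProb_le (hp0 : 0 ≤ p) (hp1 : p ≤ 1) (hK1 : 1 ≤ K) (hK : K ≤ Fintype.card α)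
    (hq : 1 ≤ q) (hS : ∀ v, (S v).card = K) :
    isolatedProb q K p S ≤ 1 - Fintype.card ι * peq q K (Fintype.card α) p
      + ∑ z ∈ (Finset.univ : Finset ι).offDiag,
          p ^ 2 * (((S z.1 ∩ S z.2).card / (K : ℝ)) * ((K : ℝ) ^ 2 / Fintype.card α) ^ q
            + (((K : ℝ) ^ 2 / Fintype.card α) ^ q) ^ 2) := by
  calc isolatedProb q K p S
      ≤ ∑ s, ringWeight α K s * (1 - ∑ v, p * shareInd q (S v) s
          + ∑ z ∈ (Finset.univ : Finset ι).offDiag,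
            (p * shareInd q (S z.1) s) * (p * shareInd q (S z.2) s)) := by
        unfold isolatedProb
        gcongr with s _
        · exact ringWeight_nonneg K s
        · refine prod_one_sub_le _ _ (fun v _ => mul_nonneg hp0 (shareInd_nonneg _ _ _))
            fun v _ => mul_le_one₀ hp1 (shareInd_nonneg _ _ _) (shareInd_le_one _ _ _)
    _ = 1 - Fintype.card ι * peq q K (Fintype.card α) p
          + ∑ z ∈ (Finset.univ : Finset ι).offDiag, ∑ s, ringWeight α K s *
            ((p * shareInd q (S z.1) s) * (p * shareInd q (S z.2) s)) := by
        simp_rw [mul_add, mul_sub, Finset.sum_add_distrib, Finset.sum_sub_distrib, mul_one,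
          sum_ringWeight hK, Finset.mul_sum]
        congr 1
        · rw [Finset.sum_comm]
          simp_rw [sum_shareInd hK (hS _)]
          simp
        · rw [Finset.sum_comm]
    _ ≤ _ := by
        gcongr with z _
        exact sum_shareInd_both_le hK1 hK hq (hS _) (hS _)

lemma sum_exactEdge_some_ge (hp0 : 0 ≤ p) (hp1 : p ≤ 1) (hK1 : 1 ≤ K)
    (hK : K ≤ Fintype.card α) (hq : 1 ≤ q) (hS : ∀ v, (S v).card = K)
    (hdis : ∀ v v', v ≠ v' → Disjoint (S v) (S v')) (v₀ : ι) :
    peq q K (Fintype.card α) p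
        - Fintype.card ι * (p ^ 2 * (((K : ℝ) ^ 2 / Fintype.card α) ^ q) ^ 2)
      ≤ ∑ s, ringWeight α K s * ∏ v : ι, (if q ≤ (S v ∩ s).card
        then p * exactEdge (some v₀) v true + (1 - p) * exactEdge (some v₀) v false
        else exactEdge (some v₀) v false) := by
  have h1 : ∀ s, ∏ v : ι, (if q ≤ (S v ∩ s).card
        then p * exactEdge (some v₀) v true + (1 - p) * exactEdge (some v₀) v false
        else exactEdge (some v₀) v false)
      = (p * shareInd q (S v₀) s) *
        ∏ v ∈ Finset.univ.erase v₀, (1 - p * shareInd q (S v) s) := by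
    intro s
    rw [← Finset.mul_prod_erase _ _ (Finset.mem_univ v₀)]
    congr 1
    · by_cases h : q ≤ (S v₀ ∩ s).card <;> simp [exactEdge, shareInd, h]
    · refine Finset.prod_congr rfl fun v hv => ?_
      have hv' : v₀ ≠ v := (Finset.ne_of_mem_erase hv).symm
      by_cases h : q ≤ (S v ∩ s).card <;> simp [exactEdge, shareInd, h, hv']
  simp_rw [h1]
  calc _ ≤ peq q K (Fintype.card α) p - ∑ v ∈ Finset.univ.erase v₀,
          (p ^ 2 * (((K : ℝ) ^ 2 / Fintype.card α) ^ q) ^ 2) := by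
        rw [Finset.sum_const, nsmul_eq_mul]
        have : ((Finset.univ.erase v₀).card : ℝ) ≤ Fintype.card ι := by
          exact_mod_cast Finset.card_le_univ _
        gcongr
    _ ≤ peq q K (Fintype.card α) p - ∑ v ∈ Finset.univ.erase v₀, ∑ s, ringWeight α K s *
          ((p * shareInd q (S v₀) s) * (p * shareInd q (S v) s)) := by
        gcongr with v hv
        have hv' : v₀ ≠ v := (Finset.ne_of_mem_erase hv).symm
        have := sum_shareInd_both_le (p := p) hK1 hK hq (hS v₀) (hS v)
        rw [Finset.disjoint_iff_inter_eq_empty.1 (hdis _ _ hv')] at this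
        simpa using this
    _ = ∑ s, ringWeight α K s * ((p * shareInd q (S v₀) s) *
          (1 - ∑ v ∈ Finset.univ.erase v₀, p * shareInd q (S v) s)) := by
        rw [← sum_shareInd hK (hS v₀), Finset.sum_comm, ← Finset.sum_sub_distrib]
        refine Finset.sum_congr rfl fun s _ => ?_
        rw [← Finset.mul_sum, ← Finset.mul_sum]
        ring
    _ ≤ _ := by
        gcongr with s _
        · exact ringWeight_nonneg K s
        · exact mul_nonneg hp0 (shareInd_nonneg _ _ _)
        · refine one_sub_sum_le_prod _ _ (fun v _ => mul_nonneg hp0 (shareInd_nonneg _ _ _))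
            fun v _ => mul_le_one₀ hp1 (shareInd_nonneg _ _ _) (shareInd_le_one _ _ _)

end EdgePatterns

section Degrees

variable {q n K P : ℕ} {p : ℝ}

/-- Indicator that all the vertices in `V` have degree at most `j`. -/
noncomputable def lowDegInd (q j : ℕ) {n P : ℕ} (V : Finset (Fin n)) (ω : Config n P) : ℝ :=
  open scoped Classical in if ∀ v ∈ V, degree q n P ω v ≤ j then 1 else 0

lemma degree_eq (ω : Config n P) (v : Fin n) :
    degree q n P ω v = #{w | w ≠ v ∧ adjBool q n P ω v w = true} := by
  unfold degree
  rw [Nat.subtype_card]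
  intro w
  simp [Adj, adjBool, ne_comm]

lemma weight_nonneg (hp0 : 0 ≤ p) (hp1 : p ≤ 1) (ω : Config n P) : 0 ≤ weight n K P p ω := by
  rw [weight_eq]
  refine mul_nonneg (prod_ringWeight_nonneg K _) (Finset.prod_nonneg fun e _ => ?_)
  split_ifs <;> linarith

lemma sum_weight (hK : K ≤ P) : ∑ ω : Config n P, weight n K P p ω = 1 := by
  have h := sum_weight_prod 0 n K P p Finset.univ (fun _ => 1) (fun _ _ _ => 1)
  have hK' : K ≤ Fintype.card (Fin P) := by simpa using hK
  simp only [Finset.prod_const_one, mul_one] at h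
  rw [h]
  have : IsEmpty {w : Fin n // w ∉ (Finset.univ : Finset (Fin n))} := ⟨fun w => w.2 (by simp)⟩
  simp only [Finset.univ_eq_empty, Finset.prod_empty, mul_one]
  exact sum_pi_ringWeight hK'

/-- The number of neighbours outside `V` is at most the degree. -/
lemma card_outside_le_degree (V : Finset (Fin n)) (ω : Config n P) (v : {v // v ∈ V}) :
    #{w : {w // w ∉ V} | adjBool q n P ω v w = true} ≤ degree q n P ω v := by
  rw [degree_eq]
  refine Finset.card_le_card_of_injOn Subtype.val ?_ Subtype.val_injective.injOn
  intro w hw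
  simp only [Finset.coe_filter, Finset.mem_univ, true_and, Set.mem_ofPred_eq] at hw ⊢
  exact ⟨fun h => w.2 (h ▸ v.2), hw⟩

lemma degree_eq_card_outside (hq : 1 ≤ q) (V : Finset (Fin n)) (ω : Config n P)
    (hdis : ∀ v v' : {v // v ∈ V}, v ≠ v' → Disjoint (ω.1 v) (ω.1 v')) (v : {v // v ∈ V}) :
    degree q n P ω v = #{w : {w // w ∉ V} | adjBool q n P ω v w = true} := by
  refine le_antisymm ?_ (card_outside_le_degree V ω v)
  rw [degree_eq]
  refine Finset.card_le_card_of_surjOn Subtype.val ?_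
  intro w hw
  simp only [Finset.coe_filter, Finset.mem_univ, true_and, Set.mem_ofPred_eq] at hw
  have hwV : w ∉ V := by
    intro hwV
    have h1 := hdis v ⟨w, hwV⟩ (fun h => hw.1 (by rw [h]))
    have h2 := hw.2
    simp only [adjBool, Bool.and_eq_true, decide_eq_true_eq] at h2
    rw [Finset.disjoint_iff_inter_eq_empty.1 h1] at h2
    simp at h2
    omega
  exact ⟨⟨w, hwV⟩, by simpa using hw.2, rfl⟩

lemma lowDegInd_le (j : ℕ) (V : Finset (Fin n)) (ω : Config n P) :
    lowDegInd q j V ω ≤ ∑ f : {w // w ∉ V} → Option {v // v ∈ V} with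
      ∀ v, (fiber f v).card ≤ j, ∏ w, ∏ v, forcedEdge (f w) v (adjBool q n P ω v w) := by
  have hnn : ∀ f : {w // w ∉ V} → Option {v // v ∈ V},
      0 ≤ ∏ w, ∏ v, forcedEdge (f w) v (adjBool q n P ω v w) := fun f =>
    Finset.prod_nonneg fun w _ => Finset.prod_nonneg fun v _ => by
      unfold forcedEdge; split_ifs <;> norm_num
  unfold lowDegInd
  split_ifs with h
  swap
  · exact Finset.sum_nonneg fun f _ => hnn f
  classical
  let f : {w // w ∉ V} → Option {v // v ∈ V} := fun w =>
    if h : ∃ v : {v // v ∈ V}, adjBool q n P ω v w = true then some h.choose else none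
  have hf : ∀ w v, f w = some v → adjBool q n P ω v w = true := by
    intro w v hv
    by_cases hw : ∃ v : {v // v ∈ V}, adjBool q n P ω v w = true
    · simp only [f, dif_pos hw, Option.some.injEq] at hv
      rw [← hv]; exact hw.choose_spec
    · simp only [f, dif_neg hw, reduceCtorEq] at hv
  have hf' : ∀ w, f w = none → ∀ v : {v // v ∈ V}, adjBool q n P ω v w = false := by
    intro w hw v
    by_contra hne
    have : ∃ v : {v // v ∈ V}, adjBool q n P ω v w = true := ⟨v, by simpa using hne⟩
    simp only [f, dif_pos this, reduceCtorEq] at hw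
  have hmem : f ∈ ({f | ∀ v, (fiber f v).card ≤ j} :
      Finset ({w // w ∉ V} → Option {v // v ∈ V})) := by
    simp only [Finset.mem_filter, Finset.mem_univ, true_and]
    intro v
    refine le_trans (Finset.card_le_card ?_) ((card_outside_le_degree V ω v).trans (h v v.2))
    intro w hw
    rw [mem_fiber] at hw
    simp [hf w v hw]
  have h1 : ∏ w, ∏ v, forcedEdge (f w) v (adjBool q n P ω v w) = 1 := by
    refine Finset.prod_eq_one fun w _ => Finset.prod_eq_one fun v _ => ?_
    unfold forcedEdge
    rw [if_pos ⟨fun h0 => hf' w h0 v, hf w v⟩]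
  calc (1 : ℝ) = ∏ w, ∏ v, forcedEdge (f w) v (adjBool q n P ω v w) := h1.symm
    _ ≤ _ := Finset.single_le_sum
        (f := fun f : {w // w ∉ V} → Option {v // v ∈ V} =>
          ∏ w, ∏ v, forcedEdge (f w) v (adjBool q n P ω v w)) (fun f _ => hnn f) hmem

lemma lowDegInd_ge (hq : 1 ≤ q) (j : ℕ) (V : Finset (Fin n)) (ω : Config n P) :
    (if ∀ v v' : {v // v ∈ V}, v ≠ v' → Disjoint (ω.1 v) (ω.1 v') then (1 : ℝ) else 0) *
      ∑ f : {w // w ∉ V} → Option {v // v ∈ V} with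
        ∀ v, (fiber f v).card = j, ∏ w, ∏ v, exactEdge (f w) v (adjBool q n P ω v w)
      ≤ lowDegInd q j V ω := by
  have hnn : 0 ≤ lowDegInd q j V ω := by unfold lowDegInd; split_ifs <;> norm_num
  split_ifs with hdis
  swap
  · simpa using hnn
  rw [one_mul]
  have h1 : ∀ f : {w // w ∉ V} → Option {v // v ∈ V},
      ∏ w, ∏ v, exactEdge (f w) v (adjBool q n P ω v w)
        = if ∀ w v, (f w = some v ↔ adjBool q n P ω v w = true) then 1 else 0 := by
    intro f
    simp only [exactEdge, Fintype.prod_boole]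
  simp_rw [h1]
  by_cases hex : ∃ f : {w // w ∉ V} → Option {v // v ∈ V}, (∀ v, (fiber f v).card = j) ∧
      ∀ w v, (f w = some v ↔ adjBool q n P ω v w = true)
  · obtain ⟨f₀, hj, hf₀⟩ := hex
    rw [Finset.sum_eq_single f₀]
    · rw [if_pos hf₀]
      unfold lowDegInd
      rw [if_pos]
      intro v hv
      have h2 := degree_eq_card_outside hq V ω hdis ⟨v, hv⟩
      simp only at h2
      rw [h2, ← hj ⟨v, hv⟩]
      refine Finset.card_le_card fun w hw => ?_
      rw [mem_fiber, hf₀]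
      simpa using hw
    · intro f _ hne
      rw [if_neg]
      intro hf
      apply hne
      funext w
      ext v
      rw [hf, hf₀]
    · intro hnot
      exact absurd (by simpa using hj) hnot
  · rw [Finset.sum_eq_zero]
    · exact hnn
    · intro f hf
      rw [if_neg]
      intro h2
      exact hex ⟨f, (Finset.mem_filter.1 hf).2, h2⟩

end Degrees

section LowDegree

variable {q n K P : ℕ} {p : ℝ}

lemma psq_nonneg (hK : K ≤ P) : 0 ≤ psq q K P := by
  have hK' : K ≤ (Finset.univ : Finset (Fin P)).card := by simpa using hK
  obtain ⟨t, -, ht⟩ := Finset.exists_subset_card_eq hK'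
  have h := sum_ringWeight_share (by simpa using hK') q t ht
  rw [Fintype.card_fin] at h
  rw [← h]
  exact Finset.sum_nonneg fun s _ => mul_nonneg (ringWeight_nonneg K s) (by split_ifs <;> norm_num)

lemma peq_nonneg (hp0 : 0 ≤ p) (hK : K ≤ P) : 0 ≤ peq q K P p :=
  mul_nonneg hp0 (psq_nonneg hK)

lemma prod_ringWeight_eq_zero {ι : Type*} [Fintype ι] {S : ι → Finset (Fin P)}
    (hS : ¬ ∀ v, (S v).card = K) : ∏ v, ringWeight (Fin P) K (S v) = 0 := by
  push Not at hS
  obtain ⟨v, hv⟩ := hS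
  exact Finset.prod_eq_zero (Finset.mem_univ v) (by simp [ringWeight, hv])

lemma card_not_mem (V : Finset (Fin n)) : Fintype.card {w // w ∉ V} = n - V.card := by
  rw [Fintype.card_subtype_compl, Fintype.card_fin, Fintype.card_coe]

/-- Upper bound for the contribution of one prescribed pattern of edges leaving `V`. -/
lemma prod_forcedEdge_le (hp0 : 0 ≤ p) (hp1 : p ≤ 1) (hK1 : 1 ≤ K) (hK : K ≤ P) (hq : 1 ≤ q)
    (j : ℕ) (V : Finset (Fin n)) (f : {w // w ∉ V} → Option {v // v ∈ V})
    (hf : ∀ v, (fiber f v).card ≤ j) (S : {v // v ∈ V} → Finset (Fin P))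
    (hS : ∀ v, (S v).card = K) :
    ∏ w : {w // w ∉ V}, ∑ s, ringWeight (Fin P) K s *
          ∏ v : {v // v ∈ V}, (if q ≤ (S v ∩ s).card
            then p * forcedEdge (f w) v true + (1 - p) * forcedEdge (f w) v false
            else forcedEdge (f w) v false)
      ≤ Real.exp (n * p ^ 2 * ((K : ℝ) ^ 2 / P) ^ q / K *
            ∑ z ∈ (Finset.univ : Finset {v // v ∈ V}).offDiag, ((S z.1 ∩ S z.2).card : ℝ)) *
        (Real.exp (-(V.card * peq q K P p * (n - V.card - V.card * j))) *
          Real.exp (n * (p ^ 2 * (((K : ℝ) ^ 2 / P) ^ q) ^ 2 * (V.card : ℝ) ^ 2)) *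
          ∏ v, peq q K P p ^ (fiber f v).card) := by
  have hK' : K ≤ Fintype.card (Fin P) := by simpa using hK
  have he : 0 ≤ peq q K P p := peq_nonneg hp0 hK
  set m := V.card with hm
  set e := peq q K P p with he_def
  set x : ℝ := (K : ℝ) ^ 2 / P with hx
  obtain ⟨T, hT⟩ : ∃ T : ℝ,
      T = ∑ z ∈ (Finset.univ : Finset {v // v ∈ V}).offDiag, ((S z.1 ∩ S z.2).card : ℝ) := ⟨_, rfl⟩
  have hcard : Fintype.card {v // v ∈ V} = m := Fintype.card_coe V
  have hx0 : 0 ≤ x := by positivity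
  rw [← hT]
  have hT0 : 0 ≤ T := hT ▸ Finset.sum_nonneg fun z _ => Nat.cast_nonneg _
  have h1 : ∀ w, ∑ s, ringWeight (Fin P) K s *
          ∏ v : {v // v ∈ V}, (if q ≤ (S v ∩ s).card
            then p * forcedEdge (f w) v true + (1 - p) * forcedEdge (f w) v false
            else forcedEdge (f w) v false) = if f w = none then isolatedProb q K p S else e := by
    intro w
    rcases h : f w with _ | v₀
    · rw [if_pos rfl, sum_forcedEdge_none]
    · rw [sum_forcedEdge_some hK' hS v₀, Fintype.card_fin, if_neg (Option.some_ne_none v₀)]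
  rw [Finset.prod_congr rfl fun w _ => h1 w, prod_eq_prod_fiber]
  set R : ℝ := p ^ 2 * x ^ q / K * T + p ^ 2 * (x ^ q) ^ 2 * (m : ℝ) ^ 2 with hR
  have hR0 : 0 ≤ R := by positivity
  have hiso : isolatedProb q K p S ≤ Real.exp (-(m * e) + R) := by
    have h2 := isolatedProb_le hp0 hp1 hK1 hK' hq hS
    rw [Fintype.card_fin, hcard] at h2
    refine h2.trans (le_trans ?_ (Real.add_one_le_exp _))
    have h3 : ∑ z ∈ (Finset.univ : Finset {v // v ∈ V}).offDiag,
          p ^ 2 * (((S z.1 ∩ S z.2).card / (K : ℝ)) * ((K : ℝ) ^ 2 / P) ^ q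
            + (((K : ℝ) ^ 2 / P) ^ q) ^ 2)
        = p ^ 2 * x ^ q / K * T
          + p ^ 2 * (x ^ q) ^ 2 * ((Finset.univ : Finset {v // v ∈ V}).offDiag.card : ℝ) := by
      rw [hT, Finset.mul_sum, mul_comm _ (((Finset.univ : Finset {v // v ∈ V}).offDiag.card : ℝ)),
        ← nsmul_eq_mul, ← Finset.sum_const, ← Finset.sum_add_distrib]
      exact Finset.sum_congr rfl fun z _ => by ring
    have h4 : ((Finset.univ : Finset {v // v ∈ V}).offDiag.card : ℝ) ≤ (m : ℝ) ^ 2 := by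
      rw [Finset.offDiag_card, Finset.card_univ, hcard]
      calc ((m * m - m : ℕ) : ℝ) ≤ ((m * m : ℕ) : ℝ) := by exact_mod_cast Nat.sub_le _ _
        _ = (m : ℝ) ^ 2 := by push_cast; ring
    rw [h3]
    have h5 : p ^ 2 * (x ^ q) ^ 2 * ((Finset.univ : Finset {v // v ∈ V}).offDiag.card : ℝ)
        ≤ p ^ 2 * (x ^ q) ^ 2 * (m : ℝ) ^ 2 := by gcongr
    rw [hR]
    linarith
  have hcardJ : #{w | f w = none} + ∑ v, (fiber f v).card = n - m := by
    rw [← card_eq_sum_fiber f, card_not_mem]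
  have hmn : m ≤ n := by simpa using Finset.card_le_univ V
  have hsum : ∑ v, (fiber f v).card ≤ m * j := by
    calc _ ≤ ∑ v : {v // v ∈ V}, j := Finset.sum_le_sum fun v _ => hf v
      _ = m * j := by rw [Finset.sum_const, Finset.card_univ, hcard, smul_eq_mul]
  have hle : (#{w | f w = none} : ℝ) ≤ n := by exact_mod_cast (by omega)
  have hge : (n : ℝ) - m - m * j ≤ #{w | f w = none} := by
    have : n ≤ #{w | f w = none} + m * j + m := by omega
    have : (n : ℝ) ≤ #{w | f w = none} + m * j + m := by exact_mod_cast this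
    linarith
  rw [← mul_assoc, ← Real.exp_add, ← Real.exp_add]
  refine mul_le_mul_of_nonneg_right ?_ (Finset.prod_nonneg fun v _ => pow_nonneg he _)
  calc _ ≤ Real.exp (-(m * e) + R) ^ #{w | f w = none} :=
        pow_le_pow_left₀ (isolatedProb_nonneg hp0 hp1) hiso _
    _ = Real.exp (#{w | f w = none} * (-(m * e) + R)) := (Real.exp_nat_mul _ _).symm
    _ ≤ _ := by
        refine Real.exp_le_exp.2 ?_
        have h6 : (#{w | f w = none} : ℝ) * R ≤ n * R := mul_le_mul_of_nonneg_right hle hR0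
        have h7 : (m * e) * ((n : ℝ) - m - m * j) ≤ (m * e) * #{w | f w = none} :=
          mul_le_mul_of_nonneg_left hge (by positivity)
        have h8 : n * p ^ 2 * x ^ q / K * T + n * (p ^ 2 * (x ^ q) ^ 2 * (m : ℝ) ^ 2) = n * R := by
          rw [hR]; ring
        linarith

lemma sum_lowDegInd_le (hp0 : 0 ≤ p) (hp1 : p ≤ 1) (hK1 : 1 ≤ K) (hK : K ≤ P) (hq : 1 ≤ q)
    (j : ℕ) (V : Finset (Fin n)) :
    ∑ ω : Config n P, weight n K P p ω * lowDegInd q j V ω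
      ≤ Real.exp (-(V.card * peq q K P p * (n - V.card - V.card * j))) *
          Real.exp (n * (p ^ 2 * (((K : ℝ) ^ 2 / P) ^ q) ^ 2 * (V.card : ℝ) ^ 2)) *
          (∑ i ∈ Finset.range (j + 1), ((n : ℝ) * peq q K P p) ^ i / i.factorial) ^ V.card *
          (1 + (V.card : ℝ) ^ 2 * (Real.exp ((Real.exp ((V.card : ℝ) ^ 2 *
            (n * p ^ 2 * ((K : ℝ) ^ 2 / P) ^ q / K)) - 1) * ((K : ℝ) ^ 2 / P)) - 1)) := by
  have hK' : K ≤ Fintype.card (Fin P) := by simpa using hK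
  have he : 0 ≤ peq q K P p := peq_nonneg hp0 hK
  set θ : ℝ := n * p ^ 2 * ((K : ℝ) ^ 2 / P) ^ q / K with hθ
  have hθ0 : 0 ≤ θ := by positivity
  set A : ℝ := Real.exp (-(V.card * peq q K P p * (n - V.card - V.card * j))) *
          Real.exp (n * (p ^ 2 * (((K : ℝ) ^ 2 / P) ^ q) ^ 2 * (V.card : ℝ) ^ 2)) with hA
  have hA0 : 0 ≤ A := by positivity
  calc ∑ ω : Config n P, weight n K P p ω * lowDegInd q j V ω
      ≤ ∑ ω : Config n P, weight n K P p ω *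
          ∑ f : {w // w ∉ V} → Option {v // v ∈ V} with ∀ v, (fiber f v).card ≤ j,
            1 * ∏ w, ∏ v, forcedEdge (f w) v (adjBool q n P ω v w) := by
        simp_rw [one_mul]
        exact Finset.sum_le_sum fun ω _ =>
          mul_le_mul_of_nonneg_left (lowDegInd_le j V ω) (weight_nonneg hp0 hp1 ω)
    _ = ∑ f : {w // w ∉ V} → Option {v // v ∈ V} with ∀ v, (fiber f v).card ≤ j,
          ∑ S : {v // v ∈ V} → Finset (Fin P), (∏ v, ringWeight (Fin P) K (S v)) *
            (1 * ∏ w : {w // w ∉ V}, ∑ s, ringWeight (Fin P) K s *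
          ∏ v : {v // v ∈ V}, (if q ≤ (S v ∩ s).card
            then p * forcedEdge (f w) v true + (1 - p) * forcedEdge (f w) v false
            else forcedEdge (f w) v false)) := by
        simp_rw [Finset.mul_sum]
        rw [Finset.sum_comm]
        exact Finset.sum_congr rfl fun f _ =>
          sum_weight_prod q n K P p V (fun _ => 1) fun v w b => forcedEdge (f w) v b
    _ ≤ ∑ f : {w // w ∉ V} → Option {v // v ∈ V} with ∀ v, (fiber f v).card ≤ j,
          ∑ S : {v // v ∈ V} → Finset (Fin P), (∏ v, ringWeight (Fin P) K (S v)) *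
            (Real.exp (θ * ∑ z ∈ (Finset.univ : Finset {v // v ∈ V}).offDiag,
              ((S z.1 ∩ S z.2).card : ℝ)) * (A * ∏ v, peq q K P p ^ (fiber f v).card)) := by
        refine Finset.sum_le_sum fun f hf => Finset.sum_le_sum fun S _ => ?_
        by_cases hS : ∀ v, (S v).card = K
        · rw [one_mul]
          exact mul_le_mul_of_nonneg_left
            (prod_forcedEdge_le hp0 hp1 hK1 hK hq j V f (Finset.mem_filter.1 hf).2 S hS)
            (prod_ringWeight_nonneg K S)
        · rw [prod_ringWeight_eq_zero hS, zero_mul, zero_mul]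
    _ = A * (∑ f : {w // w ∉ V} → Option {v // v ∈ V} with ∀ v, (fiber f v).card ≤ j,
          ∏ v, peq q K P p ^ (fiber f v).card) *
          ∑ S : {v // v ∈ V} → Finset (Fin P), (∏ v, ringWeight (Fin P) K (S v)) *
            Real.exp (θ * ∑ z ∈ (Finset.univ : Finset {v // v ∈ V}).offDiag,
              ((S z.1 ∩ S z.2).card : ℝ)) := by
        rw [mul_assoc, Finset.sum_mul_sum, Finset.mul_sum]
        refine Finset.sum_congr rfl fun f _ => ?_
        rw [Finset.mul_sum]
        exact Finset.sum_congr rfl fun S _ => by ring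
    _ ≤ _ := by
        have h1 := sum_fiber_le (ι := {v // v ∈ V}) (J := {w // w ∉ V}) j he
          (n := n) (by rw [card_not_mem]; exact Nat.sub_le _ _)
        have h2 := sum_pi_ringWeight_exp_le (ι := {v // v ∈ V}) hK' hθ0
        rw [Fintype.card_coe] at h1 h2
        rw [Fintype.card_fin] at h2
        gcongr
        exact Finset.sum_nonneg fun S _ =>
          mul_nonneg (prod_ringWeight_nonneg K S) (Real.exp_nonneg _)

/-- Lower bound for the contribution of one prescribed pattern of edges leaving `V`. -/
lemma prod_exactEdge_ge (hp0 : 0 ≤ p) (hp1 : p ≤ 1) (hK1 : 1 ≤ K) (hK : K ≤ P) (hq : 1 ≤ q)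
    (j : ℕ) (V : Finset (Fin n)) (f : {w // w ∉ V} → Option {v // v ∈ V})
    (hf : ∀ v, (fiber f v).card = j) (S : {v // v ∈ V} → Finset (Fin P))
    (hS : ∀ v, (S v).card = K) (hdis : ∀ v v', v ≠ v' → Disjoint (S v) (S v'))
    (h0 : V.card * peq q K P p ≤ 1)
    (h0' : V.card * (p ^ 2 * (((K : ℝ) ^ 2 / P) ^ q) ^ 2) ≤ peq q K P p) :
    (1 - V.card * peq q K P p) ^ n *
        ((peq q K P p - V.card * (p ^ 2 * (((K : ℝ) ^ 2 / P) ^ q) ^ 2)) ^ j) ^ V.card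
      ≤ ∏ w : {w // w ∉ V}, ∑ s, ringWeight (Fin P) K s *
          ∏ v : {v // v ∈ V}, (if q ≤ (S v ∩ s).card
            then p * exactEdge (f w) v true + (1 - p) * exactEdge (f w) v false
            else exactEdge (f w) v false) := by
  have hK' : K ≤ Fintype.card (Fin P) := by simpa using hK
  have he : 0 ≤ peq q K P p := peq_nonneg hp0 hK
  have hcard : Fintype.card {v // v ∈ V} = V.card := Fintype.card_coe V
  set a := 1 - V.card * peq q K P p with ha
  set e' := peq q K P p - V.card * (p ^ 2 * (((K : ℝ) ^ 2 / P) ^ q) ^ 2) with he'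
  have ha0 : 0 ≤ a := by linarith
  have ha1 : a ≤ 1 := by
    have : 0 ≤ V.card * peq q K P p := by positivity
    linarith
  have he0 : 0 ≤ e' := by linarith
  have hcardJ : #{w | f w = none} + ∑ v, (fiber f v).card = n - V.card := by
    rw [← card_eq_sum_fiber f, card_not_mem]
  calc a ^ n * (e' ^ j) ^ V.card
      ≤ a ^ #{w | f w = none} * (e' ^ j) ^ V.card := by
        refine mul_le_mul_of_nonneg_right ?_ (by positivity)
        exact pow_le_pow_of_le_one ha0 ha1 (by omega)
    _ = a ^ #{w | f w = none} * ∏ v, e' ^ (fiber f v).card := by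
        simp_rw [hf]
        rw [Finset.prod_const, Finset.card_univ, hcard]
    _ = ∏ w, (if f w = none then a else e') := (prod_eq_prod_fiber f a e').symm
    _ ≤ _ := by
        refine Finset.prod_le_prod (fun w _ => by split_ifs <;> assumption) fun w _ => ?_
        rcases h : f w with _ | v₀
        · rw [if_pos rfl, sum_exactEdge_none]
          have := isolatedProb_ge (q := q) hp0 hp1 hK' hS
          rwa [hcard, Fintype.card_fin] at this
        · rw [if_neg (Option.some_ne_none v₀)]
          have := sum_exactEdge_some_ge (q := q) hp0 hp1 hK1 hK' hq hS hdis v₀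
          rwa [hcard, Fintype.card_fin] at this

lemma sum_lowDegInd_ge (hp0 : 0 ≤ p) (hp1 : p ≤ 1) (hK1 : 1 ≤ K) (hK : K ≤ P) (hq : 1 ≤ q)
    (j : ℕ) (V : Finset (Fin n)) (hj : j ≤ n - V.card)
    (hx : (V.card : ℝ) ^ 2 * ((K : ℝ) ^ 2 / P) ≤ 1)
    (h0 : V.card * peq q K P p ≤ 1)
    (h0' : V.card * (p ^ 2 * (((K : ℝ) ^ 2 / P) ^ q) ^ 2) ≤ peq q K P p) :
    (1 - (V.card : ℝ) ^ 2 * ((j : ℝ) ^ 2 / (n - V.card : ℕ))) *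
        ((n - V.card).choose j : ℝ) ^ V.card *
        ((1 - V.card * peq q K P p) ^ n *
        ((peq q K P p - V.card * (p ^ 2 * (((K : ℝ) ^ 2 / P) ^ q) ^ 2)) ^ j) ^ V.card) *
        (1 - (V.card : ℝ) ^ 2 * ((K : ℝ) ^ 2 / P))
      ≤ ∑ ω : Config n P, weight n K P p ω * lowDegInd q j V ω := by
  have hK' : K ≤ Fintype.card (Fin P) := by simpa using hK
  set B : ℝ := (1 - V.card * peq q K P p) ^ n *
        ((peq q K P p - V.card * (p ^ 2 * (((K : ℝ) ^ 2 / P) ^ q) ^ 2)) ^ j) ^ V.card with hB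
  have hB0 : 0 ≤ B :=
    mul_nonneg (pow_nonneg (by linarith) _) (pow_nonneg (pow_nonneg (by linarith) _) _)
  set D : ({v // v ∈ V} → Finset (Fin P)) → ℝ := fun S =>
    if ∀ v v', v ≠ v' → Disjoint (S v) (S v') then 1 else 0 with hD
  have h1 := card_fiber_eq_ge (ι := {v // v ∈ V}) (J := {w // w ∉ V}) (j := j)
    (by rwa [card_not_mem])
  have h2 := sum_pi_ringWeight_disjoint_ge (ι := {v // v ∈ V}) hK'
  rw [Fintype.card_coe, card_not_mem] at h1
  rw [Fintype.card_coe, Fintype.card_fin] at h2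
  calc _ ≤ (#{f : {w // w ∉ V} → Option {v // v ∈ V} | ∀ v, (fiber f v).card = j} : ℝ) * B *
          ∑ S : {v // v ∈ V} → Finset (Fin P), (∏ v, ringWeight (Fin P) K (S v)) * D S := by
        refine mul_le_mul (mul_le_mul_of_nonneg_right h1 hB0) h2 (by linarith) (by positivity)
    _ = ∑ f : {w // w ∉ V} → Option {v // v ∈ V} with ∀ v, (fiber f v).card = j,
          ∑ S : {v // v ∈ V} → Finset (Fin P), (∏ v, ringWeight (Fin P) K (S v)) * (D S * B) := by
        rw [Finset.sum_const, nsmul_eq_mul, mul_assoc, Finset.mul_sum]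
        congr 1
        exact Finset.sum_congr rfl fun S _ => by ring
    _ ≤ ∑ f : {w // w ∉ V} → Option {v // v ∈ V} with ∀ v, (fiber f v).card = j,
          ∑ S : {v // v ∈ V} → Finset (Fin P), (∏ v, ringWeight (Fin P) K (S v)) *
            (D S * ∏ w : {w // w ∉ V}, ∑ s, ringWeight (Fin P) K s *
          ∏ v : {v // v ∈ V}, (if q ≤ (S v ∩ s).card
            then p * exactEdge (f w) v true + (1 - p) * exactEdge (f w) v false
            else exactEdge (f w) v false)) := by
        refine Finset.sum_le_sum fun f hf => Finset.sum_le_sum fun S _ => ?_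
        by_cases hS : ∀ v, (S v).card = K
        · refine mul_le_mul_of_nonneg_left ?_ (prod_ringWeight_nonneg K S)
          simp only [hD]
          split_ifs with hdis
          · rw [one_mul, one_mul]
            exact prod_exactEdge_ge hp0 hp1 hK1 hK hq j V f (Finset.mem_filter.1 hf).2 S hS hdis
              h0 h0'
          · rw [zero_mul, zero_mul]
        · rw [prod_ringWeight_eq_zero hS, zero_mul, zero_mul]
    _ = ∑ ω : Config n P, weight n K P p ω *
          ∑ f : {w // w ∉ V} → Option {v // v ∈ V} with ∀ v, (fiber f v).card = j,
            D (fun v => ω.1 v) * ∏ w : {w // w ∉ V}, ∏ v : {v // v ∈ V},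
              exactEdge (f w) v (adjBool q n P ω v w) := by
        symm
        simp_rw [Finset.mul_sum]
        rw [Finset.sum_comm]
        exact Finset.sum_congr rfl fun f _ =>
          sum_weight_prod q n K P p V D fun v w b => exactEdge (f w) v b
    _ ≤ _ := by
        refine Finset.sum_le_sum fun ω _ =>
          mul_le_mul_of_nonneg_left ?_ (weight_nonneg hp0 hp1 ω)
        rw [← Finset.mul_sum]
        exact lowDegInd_ge hq j V ω

end LowDegree

section Asymptotics

/-- The mean degree. -/
noncomputable def meanDeg (q : ℕ) (K P : ℕ → ℕ) (p : ℕ → ℝ) (n : ℕ) : ℝ :=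
  n * peq q (K n) (P n) (p n)

/-- Sparse regime: growing key rings, vanishing key overlap, and logarithmic mean degree. -/
structure SparseRegime (q : ℕ) (K P : ℕ → ℕ) (p : ℕ → ℝ) : Prop where
  one_le_q : 1 ≤ q
  one_le_ring : ∀ n, 1 ≤ K n
  ring_le_pool : ∀ n, K n ≤ P n
  channel_pos : ∀ n, 0 < p n
  channel_le_one : ∀ n, p n ≤ 1
  ring_tendsto : Tendsto (fun n => (K n : ℝ)) atTop atTop
  overlap_tendsto : Tendsto (fun n => (K n : ℝ) ^ 2 / (P n : ℝ)) atTop (nhds 0)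
  meanDeg_tendsto : Tendsto (meanDeg q K P p) atTop atTop
  meanDeg_le : ∀ᶠ n : ℕ in atTop, meanDeg q K P p n ≤ 2 * Real.log n

namespace SparseRegime

variable {q : ℕ} {K P : ℕ → ℕ} {p : ℕ → ℝ}

lemma exp_meanDeg_mul_sq_div (h : SparseRegime q K P p) :
    Tendsto (fun n : ℕ => Real.exp (meanDeg q K P p n / 4) * meanDeg q K P p n ^ 2 / n)
      atTop (nhds 0) := by
  have h1 : Tendsto (fun n : ℕ => 4 * (Real.log n ^ 2 / (n : ℝ) ^ (1 / 2 : ℝ))) atTop (nhds 0) := by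
    have h2 : Tendsto (fun y : ℝ => Real.log y ^ 2 / y ^ (1 / 2 : ℝ)) atTop (nhds 0) := by
      have := (isLittleO_log_rpow_rpow_atTop (2 : ℝ) (s := 1 / 2) (by norm_num)).tendsto_div_nhds_zero
      simpa using this
    simpa using (h2.comp tendsto_natCast_atTop_atTop).const_mul 4
  refine squeeze_zero' ?_ ?_ h1
  · filter_upwards with n
    positivity
  · filter_upwards [h.meanDeg_le, h.meanDeg_tendsto.eventually_ge_atTop 0,
      eventually_ge_atTop 1] with n hn h0 hn1
    have hn0 : (0 : ℝ) < n := by exact_mod_cast hn1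
    have h3 : Real.exp (meanDeg q K P p n / 4) ≤ (n : ℝ) ^ (1 / 2 : ℝ) := by
      rw [Real.rpow_def_of_pos hn0]
      exact Real.exp_le_exp.2 (by linarith)
    have h4 : (n : ℝ) ^ (1 / 2 : ℝ) * (n : ℝ) ^ (1 / 2 : ℝ) = n := by
      rw [← Real.rpow_add hn0]; norm_num
    have h5 : 0 < (n : ℝ) ^ (1 / 2 : ℝ) := Real.rpow_pos_of_pos hn0 _
    rw [← mul_div_assoc, div_le_div_iff₀ hn0 h5]
    calc Real.exp (meanDeg q K P p n / 4) * meanDeg q K P p n ^ 2 * (n : ℝ) ^ (1 / 2 : ℝ)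
        ≤ (n : ℝ) ^ (1 / 2 : ℝ) * (2 * Real.log n) ^ 2 * (n : ℝ) ^ (1 / 2 : ℝ) := by gcongr
      _ = 4 * Real.log n ^ 2 * ((n : ℝ) ^ (1 / 2 : ℝ) * (n : ℝ) ^ (1 / 2 : ℝ)) := by ring
      _ = _ := by rw [h4]

lemma meanDeg_sq_div (h : SparseRegime q K P p) :
    Tendsto (fun n : ℕ => meanDeg q K P p n ^ 2 / n) atTop (nhds 0) := by
  refine squeeze_zero' ?_ ?_ h.exp_meanDeg_mul_sq_div
  · filter_upwards with n
    positivity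
  · filter_upwards [h.meanDeg_tendsto.eventually_ge_atTop 0] with n h0
    have : 1 ≤ Real.exp (meanDeg q K P p n / 4) := Real.one_le_exp (by linarith)
    gcongr
    exact le_mul_of_one_le_left (sq_nonneg _) this

lemma meanDeg_div (h : SparseRegime q K P p) :
    Tendsto (fun n : ℕ => meanDeg q K P p n / n) atTop (nhds 0) := by
  refine squeeze_zero' ?_ ?_ h.meanDeg_sq_div
  · filter_upwards [h.meanDeg_tendsto.eventually_ge_atTop 0] with n h0
    positivity
  · filter_upwards [h.meanDeg_tendsto.eventually_ge_atTop 1] with n h0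
    gcongr
    nlinarith

lemma peq_eq (q : ℕ) (K P : ℕ → ℕ) (p : ℕ → ℝ) {n : ℕ} (hn : 1 ≤ n) :
    peq q (K n) (P n) (p n) = meanDeg q K P p n / n := by
  have hn0 : (n : ℝ) ≠ 0 := by positivity
  unfold meanDeg
  field_simp

lemma peq_tendsto (h : SparseRegime q K P p) :
    Tendsto (fun n => peq q (K n) (P n) (p n)) atTop (nhds 0) :=
  h.meanDeg_div.congr' <| by
    filter_upwards [eventually_ge_atTop 1] with n hn
    exact (peq_eq q K P p hn).symm

lemma exists_share_ge (h : SparseRegime q K P p) : ∃ c : ℝ, 0 < c ∧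
    ∀ᶠ n : ℕ in atTop, c * ((K n : ℝ) ^ 2 / P n) ^ q ≤ psq q (K n) (P n) := by
  refine ⟨(1 / 2) * (1 / 2) ^ (2 * q) / (q.factorial : ℝ), by positivity, ?_⟩
  filter_upwards [h.overlap_tendsto.eventually_le_const (u := 1 / 4) (by norm_num),
    h.ring_tendsto.eventually_ge_atTop (2 * q : ℝ)] with n hx hK
  exact psq_lower (by exact_mod_cast hK) (h.one_le_ring n) (h.ring_le_pool n) hx

/-- The expected number of vertices adjacent to two given vertices with disjoint rings vanishes. -/
lemma common_nbr_tendsto (h : SparseRegime q K P p) :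
    Tendsto (fun n : ℕ => n * (p n ^ 2 * (((K n : ℝ) ^ 2 / P n) ^ q) ^ 2)) atTop (nhds 0) := by
  obtain ⟨c, hc, hev⟩ := h.exists_share_ge
  have h1 : Tendsto (fun n : ℕ => meanDeg q K P p n ^ 2 / n / c ^ 2) atTop (nhds 0) := by
    simpa using h.meanDeg_sq_div.div_const (c ^ 2)
  refine squeeze_zero' ?_ ?_ h1
  · filter_upwards with n
    positivity
  · filter_upwards [hev, eventually_ge_atTop 1] with n hn hn1
    have hp := h.channel_pos n
    have hn0 : (0 : ℝ) < n := by exact_mod_cast hn1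
    set y := ((K n : ℝ) ^ 2 / P n) ^ q with hy
    have hy0 : 0 ≤ y := by positivity
    have h2 : c * (p n * y) ≤ meanDeg q K P p n / n := by
      rw [← peq_eq q K P p hn1]
      unfold peq
      nlinarith
    have h3 : (c * (p n * y)) ^ 2 ≤ (meanDeg q K P p n / n) ^ 2 :=
      pow_le_pow_left₀ (by positivity) h2 2
    rw [le_div_iff₀ (by positivity)]
    calc n * (p n ^ 2 * y ^ 2) * c ^ 2 = n * (c * (p n * y)) ^ 2 := by ring
      _ ≤ n * (meanDeg q K P p n / n) ^ 2 := by gcongr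
      _ = _ := by field_simp

/-- The correction due to the intersections of the prescribed key rings vanishes. -/
lemma overlap_correction_tendsto (h : SparseRegime q K P p) {C : ℝ} (hC : 0 ≤ C) :
    Tendsto (fun n : ℕ => (Real.exp (C * (n * p n ^ 2 * ((K n : ℝ) ^ 2 / P n) ^ q / K n)) - 1) *
      ((K n : ℝ) ^ 2 / P n)) atTop (nhds 0) := by
  obtain ⟨c, hc, hev⟩ := h.exists_share_ge
  rw [Metric.tendsto_atTop']
  suffices H : ∀ ε > 0, ∀ᶠ n : ℕ in atTop,
      (Real.exp (C * (n * p n ^ 2 * ((K n : ℝ) ^ 2 / P n) ^ q / K n)) - 1) *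
        ((K n : ℝ) ^ 2 / P n) < ε by
    intro ε hε
    obtain ⟨N, hN⟩ := eventually_atTop.1 (H ε hε)
    refine ⟨N, fun n hn => ?_⟩
    rw [Real.dist_eq, sub_zero, abs_of_nonneg]
    · exact hN n hn.le
    · have : 1 ≤ Real.exp (C * (n * p n ^ 2 * ((K n : ℝ) ^ 2 / P n) ^ q / K n)) :=
        Real.one_le_exp (by positivity)
      exact mul_nonneg (by linarith) (by positivity)
  intro ε hε
  have hr : Tendsto (fun n : ℕ =>
      Real.exp (meanDeg q K P p n / 4) * meanDeg q K P p n ^ 2 / n / c) atTop (nhds 0) := by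
    simpa using h.exp_meanDeg_mul_sq_div.div_const c
  filter_upwards [hev, eventually_ge_atTop 1, hr.eventually_lt_const (pow_pos hε q),
    h.overlap_tendsto.eventually_lt_const (half_pos hε),
    h.ring_tendsto.eventually_ge_atTop (C / c),
    h.ring_tendsto.eventually_ge_atTop (4 * q * (C / c)),
    h.meanDeg_tendsto.eventually_gt_atTop 0] with n hn hn1 hrn hxn hK1 hK2 hL
  have hp := h.channel_pos n
  have hp1 := h.channel_le_one n
  have hn0 : (0 : ℝ) < n := by exact_mod_cast hn1
  have hK0 : (0 : ℝ) < K n := by exact_mod_cast h.one_le_ring n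
  set x := (K n : ℝ) ^ 2 / P n with hx
  set L := meanDeg q K P p n with hLdef
  have hx0 : 0 ≤ x := by positivity
  have hLe : L = n * (p n * psq q (K n) (P n)) := rfl
  set a := C * (n * p n ^ 2 * x ^ q / K n) with ha
  have ha0 : 0 ≤ a := by positivity
  have haL : a ≤ C / c * (p n * L) / K n := by
    have h1 : n * p n ^ 2 * (c * x ^ q) ≤ p n * L := by
      rw [hLe]
      calc n * p n ^ 2 * (c * x ^ q) ≤ n * p n ^ 2 * psq q (K n) (P n) := by gcongr
        _ = _ := by ring
    calc a = C / c * (n * p n ^ 2 * (c * x ^ q)) / K n := by rw [ha]; field_simp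
      _ ≤ _ := by gcongr
  by_cases ha1 : a ≤ 1
  · have : Real.exp a ≤ 3 := (Real.exp_le_exp.2 ha1).trans (by linarith [Real.exp_one_lt_d9])
    nlinarith
  · push Not at ha1
    have hpL : 1 ≤ p n * L := by
      by_contra hcon
      push Not at hcon
      have h1 : C / c * (p n * L) / K n ≤ 1 := by
        rw [div_le_one hK0]
        calc C / c * (p n * L) ≤ C / c * 1 := by gcongr
          _ ≤ K n := by linarith
      linarith
    have hxq : x ^ q ≤ L ^ 2 / n / c := by
      rw [le_div_iff₀ hc, le_div_iff₀ hn0]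
      calc x ^ q * c * n = (c * x ^ q) * n := by ring
        _ ≤ psq q (K n) (P n) * n := by gcongr
        _ = psq q (K n) (P n) * n * 1 := by ring
        _ ≤ psq q (K n) (P n) * n * (p n * L) := by
            have := psq_nonneg (q := q) (h.ring_le_pool n)
            gcongr
        _ = L ^ 2 := by rw [sq]; nth_rw 2 [hLe]; ring
    have hqa : q * a ≤ L / 4 := by
      calc q * a ≤ q * (C / c * (p n * L) / K n) := by gcongr
        _ ≤ q * (C / c * (1 * L) / K n) := by gcongr
        _ = (4 * q * (C / c)) * (L / 4) / K n := by ring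
        _ ≤ K n * (L / 4) / K n := by gcongr
        _ = L / 4 := by field_simp
    have hpow : (Real.exp a * x) ^ q < ε ^ q := by
      calc (Real.exp a * x) ^ q = Real.exp (q * a) * x ^ q := by
            rw [mul_pow, ← Real.exp_nat_mul]
        _ ≤ Real.exp (L / 4) * (L ^ 2 / n / c) := by gcongr
        _ = Real.exp (L / 4) * L ^ 2 / n / c := by ring
        _ < ε ^ q := hrn
    have := lt_of_pow_lt_pow_left₀ q hε.le hpow
    linarith

end SparseRegime

end Asymptotics

section PoissonMass

lemma tendsto_sum_pow_div_factorial (j : ℕ) :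
    Tendsto (fun y : ℝ => (∑ i ∈ Finset.range (j + 1), y ^ i / i.factorial) /
      (y ^ j / j.factorial)) atTop (nhds 1) := by
  have h1 : Tendsto (fun y : ℝ => ∑ i ∈ Finset.range j,
      (y ^ i / y ^ j) * (j.factorial / i.factorial)) atTop (nhds (∑ i ∈ Finset.range j, 0)) := by
    refine tendsto_finsetSum _ fun i hi => ?_
    simpa using (tendsto_pow_div_pow_atTop_zero (𝕜 := ℝ) (Finset.mem_range.1 hi)).mul_const
      ((j.factorial : ℝ) / i.factorial)
  have h2 := h1.add_const 1
  rw [Finset.sum_const_zero, zero_add] at h2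
  refine h2.congr' ?_
  filter_upwards [eventually_gt_atTop 0] with y hy
  have hj : y ^ j / (j.factorial : ℝ) ≠ 0 := by positivity
  rw [Finset.sum_range_succ, add_div, div_self hj, Finset.sum_div]
  congr 1
  refine Finset.sum_congr rfl fun i _ => ?_
  field_simp

lemma tendsto_choose_sub_div (m j : ℕ) :
    Tendsto (fun n : ℕ => ((n - m).choose j : ℝ) / ((n : ℝ) ^ j / j.factorial))
      atTop (nhds 1) := by
  have h1 : Tendsto (fun n : ℕ => (n.choose j : ℝ) / ((n : ℝ) ^ j / j.factorial))
      atTop (nhds 1) := by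
    refine (Asymptotics.isEquivalent_iff_tendsto_one ?_).1 (isEquivalent_choose j)
    filter_upwards [eventually_ge_atTop 1] with n hn
    positivity
  have h2 : Tendsto (fun n : ℕ => (n : ℝ) / ((n + m : ℕ) : ℝ)) atTop (nhds 1) := by
    simpa using tendsto_natCast_div_add_atTop (𝕜 := ℝ) (m : ℝ)
  rw [← tendsto_add_atTop_iff_nat m]
  have h3 := h1.mul (h2.pow j)
  rw [one_pow, mul_one] at h3
  refine h3.congr' ?_
  filter_upwards [eventually_ge_atTop 1] with n hn
  rw [Nat.add_sub_cancel, div_pow]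
  have : (0 : ℝ) < n := by exact_mod_cast hn
  have : (0 : ℝ) < (n + m : ℕ) := by exact_mod_cast (by omega)
  field_simp

lemma tendsto_one_sub_pow_mul_exp {t : ℕ → ℝ} (ht : ∀ n, 0 ≤ t n)
    (h : Tendsto t atTop (nhds 0))
    (h2 : Tendsto (fun n : ℕ => (n : ℝ) * t n ^ 2) atTop (nhds 0)) :
    Tendsto (fun n : ℕ => (1 - t n) ^ n * Real.exp (n * t n)) atTop (nhds 1) := by
  have h3 : Tendsto (fun n : ℕ => 1 - (n : ℝ) * t n ^ 2) atTop (nhds 1) := by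
    simpa using h2.const_sub 1
  refine tendsto_of_tendsto_of_tendsto_of_le_of_le' h3 tendsto_const_nhds ?_ ?_
  · filter_upwards [h.eventually_le_const (u := 1) (by norm_num)] with n hn
    have h4 : 1 - t n ^ 2 ≤ (1 - t n) * Real.exp (t n) := by
      nlinarith [Real.add_one_le_exp (t n)]
    have h5 := one_add_mul_le_pow (a := -t n ^ 2) (by nlinarith [ht n]) n
    calc 1 - (n : ℝ) * t n ^ 2 = 1 + n * (-t n ^ 2) := by ring
      _ ≤ (1 + -t n ^ 2) ^ n := h5
      _ ≤ ((1 - t n) * Real.exp (t n)) ^ n :=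
          pow_le_pow_left₀ (by nlinarith [ht n]) (by linarith) _
      _ = _ := by rw [mul_pow, ← Real.exp_nat_mul]
  · filter_upwards [h.eventually_le_const (u := 1) (by norm_num)] with n hn
    rw [Real.exp_nat_mul, ← mul_pow]
    refine pow_le_one₀ (mul_nonneg (by linarith) (Real.exp_nonneg _)) ?_
    calc (1 - t n) * Real.exp (t n) ≤ Real.exp (-t n) * Real.exp (t n) := by
          gcongr
          linarith [Real.add_one_le_exp (-t n)]
      _ = 1 := by rw [← Real.exp_add]; simp

namespace SparseRegime

/-- The Poisson mass at `j` for the mean degree. -/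
noncomputable def poissonMass (q : ℕ) (K P : ℕ → ℕ) (p : ℕ → ℝ) (j n : ℕ) : ℝ :=
  meanDeg q K P p n ^ j / j.factorial * Real.exp (-meanDeg q K P p n)

variable {q : ℕ} {K P : ℕ → ℕ} {p : ℕ → ℝ}

lemma exists_upper (h : SparseRegime q K P p) (m j : ℕ) :
    ∃ G : ℕ → ℝ, Tendsto G atTop (nhds 1) ∧ ∀ᶠ n : ℕ in atTop, ∀ V : Finset (Fin n), V.card = m →
      ∑ ω : Config n (P n), weight n (K n) (P n) (p n) ω * lowDegInd q j V ω
        ≤ G n * poissonMass q K P p j n ^ m := by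
  refine ⟨fun n => Real.exp (m * (m + m * j) * peq q (K n) (P n) (p n)) *
      Real.exp ((n * (p n ^ 2 * (((K n : ℝ) ^ 2 / P n) ^ q) ^ 2)) * (m : ℝ) ^ 2) *
      ((∑ i ∈ Finset.range (j + 1), meanDeg q K P p n ^ i / i.factorial) /
        (meanDeg q K P p n ^ j / j.factorial)) ^ m *
      (1 + (m : ℝ) ^ 2 * (Real.exp ((Real.exp ((m : ℝ) ^ 2 *
        (n * p n ^ 2 * ((K n : ℝ) ^ 2 / P n) ^ q / K n)) - 1) * ((K n : ℝ) ^ 2 / P n)) - 1)),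
    ?_, ?_⟩
  · have h1 := (Real.continuous_exp.tendsto _).comp
      (h.peq_tendsto.const_mul ((m : ℝ) * (m + m * j)))
    have h2 := (Real.continuous_exp.tendsto _).comp (h.common_nbr_tendsto.mul_const ((m : ℝ) ^ 2))
    have h3 := ((tendsto_sum_pow_div_factorial j).comp h.meanDeg_tendsto).pow m
    have h4 := (Real.continuous_exp.tendsto _).comp
      (h.overlap_correction_tendsto (C := (m : ℝ) ^ 2) (by positivity))
    have h5 := ((h4.sub_const 1).const_mul ((m : ℝ) ^ 2)).const_add 1
    simpa using ((h1.mul h2).mul h3).mul h5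
  · filter_upwards [h.meanDeg_tendsto.eventually_gt_atTop 0] with n hL V hV
    refine (sum_lowDegInd_le (h.channel_pos n).le (h.channel_le_one n) (h.one_le_ring n)
      (h.ring_le_pool n) h.one_le_q j V).trans (le_of_eq ?_)
    rw [hV, poissonMass, mul_pow, ← Real.exp_nat_mul]
    change _ * _ * (∑ i ∈ Finset.range (j + 1), meanDeg q K P p n ^ i / i.factorial) ^ m * _ = _
    have h1 : Real.exp (-(m * peq q (K n) (P n) (p n) * (n - m - m * j)))
        = Real.exp (m * (m + m * j) * peq q (K n) (P n) (p n)) *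
          Real.exp (m * -meanDeg q K P p n) := by
      rw [← Real.exp_add, meanDeg]
      congr 1
      ring
    have h2 : meanDeg q K P p n ^ j / (j.factorial : ℝ) ≠ 0 := by positivity
    have h3 : (meanDeg q K P p n ^ j / (j.factorial : ℝ)) ^ m ≠ 0 := pow_ne_zero _ h2
    have h4 : ∀ a b c u w z : ℝ, z ≠ 0 → a * b * c * u * w = a * c * (u / z) * w * (z * b) := by
      intro a b c u w z hz
      field_simp
    rw [h1, div_pow (∑ i ∈ Finset.range (j + 1), meanDeg q K P p n ^ i / i.factorial) _ m,
      ← mul_assoc (n : ℝ) _ ((m : ℝ) ^ 2)]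
    exact h4 _ _ _ _ _ _ h3

lemma exists_lower (h : SparseRegime q K P p) (m j : ℕ) :
    ∃ G : ℕ → ℝ, Tendsto G atTop (nhds 1) ∧ ∀ᶠ n : ℕ in atTop, ∀ V : Finset (Fin n), V.card = m →
      G n * poissonMass q K P p j n ^ m
        ≤ ∑ ω : Config n (P n), weight n (K n) (P n) (p n) ω * lowDegInd q j V ω := by
  have he0 : ∀ n, 0 ≤ peq q (K n) (P n) (p n) := fun n =>
    peq_nonneg (h.channel_pos n).le (h.ring_le_pool n)
  have hs : Tendsto (fun n : ℕ => m * (n * (p n ^ 2 * (((K n : ℝ) ^ 2 / P n) ^ q) ^ 2)) /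
      meanDeg q K P p n) atTop (nhds 0) :=
    (h.common_nbr_tendsto.const_mul (m : ℝ)).div_atTop h.meanDeg_tendsto
  refine ⟨fun n => (1 - (m : ℝ) ^ 2 * ((j : ℝ) ^ 2 / (n - m : ℕ))) *
      (((n - m).choose j : ℝ) / ((n : ℝ) ^ j / j.factorial)) ^ m *
      (((1 - m * peq q (K n) (P n) (p n)) ^ n * Real.exp (n * (m * peq q (K n) (P n) (p n)))) *
        ((1 - m * (n * (p n ^ 2 * (((K n : ℝ) ^ 2 / P n) ^ q) ^ 2)) /
          meanDeg q K P p n) ^ j) ^ m) *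
      (1 - (m : ℝ) ^ 2 * ((K n : ℝ) ^ 2 / P n)), ?_, ?_⟩
  · have h1 : Tendsto (fun n : ℕ => 1 - (m : ℝ) ^ 2 * ((j : ℝ) ^ 2 / (n - m : ℕ)))
        atTop (nhds (1 - (m : ℝ) ^ 2 * 0)) :=
      ((tendsto_const_nhds.div_atTop
        (tendsto_natCast_atTop_atTop.comp (tendsto_sub_atTop_nat m))).const_mul _).const_sub 1
    have h2 := (tendsto_choose_sub_div m j).pow m
    have h3 := tendsto_one_sub_pow_mul_exp (t := fun n => m * peq q (K n) (P n) (p n))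
      (fun n => mul_nonneg (Nat.cast_nonneg _) (he0 n))
      (by simpa using h.peq_tendsto.const_mul (m : ℝ))
      (by
        have := h.meanDeg_sq_div.const_mul ((m : ℝ) ^ 2)
        rw [mul_zero] at this
        refine this.congr' ?_
        filter_upwards [eventually_ge_atTop 1] with n hn
        have hn0 : (0 : ℝ) < n := by exact_mod_cast hn
        rw [peq_eq q K P p hn]
        field_simp)
    have h4 := ((hs.const_sub 1).pow j).pow m
    have h5 := (h.overlap_tendsto.const_mul ((m : ℝ) ^ 2)).const_sub 1
    simpa using ((h1.mul h2).mul (h3.mul h4)).mul h5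
  · have hx := h.overlap_tendsto.const_mul ((m : ℝ) ^ 2)
    have he := h.peq_tendsto.const_mul (m : ℝ)
    rw [mul_zero] at hx he
    filter_upwards [h.meanDeg_tendsto.eventually_gt_atTop 0, eventually_ge_atTop (m + j + 1),
      hx.eventually_le_const (u := 1) (by norm_num), he.eventually_le_const (u := 1) (by norm_num),
      hs.eventually_le_const (u := 1) (by norm_num)] with n hL hn hxn hen hsn V hV
    have hn0 : (0 : ℝ) < n := by exact_mod_cast (by omega)
    have hLe : meanDeg q K P p n = n * peq q (K n) (P n) (p n) := rfl
    set s := p n ^ 2 * (((K n : ℝ) ^ 2 / P n) ^ q) ^ 2 with hs_def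
    set e := peq q (K n) (P n) (p n) with he_def
    have he_pos : 0 < e := by
      rw [hLe] at hL
      exact pos_of_mul_pos_right hL hn0.le
    have hse : m * s ≤ e := by
      rw [div_le_one hL, hLe] at hsn
      have : n * (m * s) ≤ n * e := by linarith
      exact le_of_mul_le_mul_left this hn0
    refine le_trans (le_of_eq ?_) (sum_lowDegInd_ge (h.channel_pos n).le (h.channel_le_one n)
      (h.one_le_ring n) (h.ring_le_pool n) h.one_le_q j V (by omega) (by rwa [hV])
      (by rwa [hV]) (by rwa [hV]))
    rw [hV, poissonMass, mul_pow, ← Real.exp_nat_mul]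
    have h1 : e - m * s = (1 - m * (n * s) / meanDeg q K P p n) * e := by
      rw [hLe]; field_simp
    have h2 : Real.exp (n * (m * e)) * Real.exp (m * -meanDeg q K P p n) = 1 := by
      rw [← Real.exp_add, hLe, Real.exp_eq_one_iff]; ring
    have h3 : (meanDeg q K P p n ^ j / (j.factorial : ℝ)) ^ m
        = ((n : ℝ) ^ j / j.factorial) ^ m * (e ^ j) ^ m := by
      rw [← mul_pow, hLe, mul_pow]; congr 1; ring
    rw [h1, mul_pow _ e j, mul_pow _ (e ^ j) m, h3, div_pow]
    have h4 : ((n : ℝ) ^ j / (j.factorial : ℝ)) ^ m ≠ 0 := by positivity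
    generalize ((n : ℝ) ^ j / (j.factorial : ℝ)) ^ m = z at h4
    calc _ = (1 - (m : ℝ) ^ 2 * ((j : ℝ) ^ 2 / (n - m : ℕ))) *
          (((n - m).choose j : ℝ) ^ m / z * z) * ((1 - m * e) ^ n *
          (((1 - m * (n * s) / meanDeg q K P p n) ^ j) ^ m * (e ^ j) ^ m)) *
          (1 - (m : ℝ) ^ 2 * ((K n : ℝ) ^ 2 / P n)) *
          (Real.exp (n * (m * e)) * Real.exp (m * -meanDeg q K P p n)) := by ring
      _ = _ := by rw [h2, mul_one, div_mul_cancel₀ _ h4]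

end SparseRegime

end PoissonMass

section Counting

/-- The number of vertices of degree at most `j`. -/
noncomputable def lowCount (q j : ℕ) {n P : ℕ} (ω : Config n P) : ℕ :=
  #{v | degree q n P ω v ≤ j}

lemma choose_lowCount (q j m : ℕ) {n P : ℕ} (ω : Config n P) :
    ((lowCount q j ω).choose m : ℝ)
      = ∑ V ∈ Finset.powersetCard m Finset.univ, lowDegInd q j V ω := by
  classical
  simp only [lowDegInd]
  rw [Finset.sum_boole, lowCount, ← Finset.card_powersetCard]
  congr 2
  ext V
  simp only [Finset.mem_powersetCard, Finset.mem_filter, true_and,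
    Finset.subset_iff, Finset.mem_univ]
  tauto

lemma abs_indicator_sub_le (y M : ℕ) :
    |(if y = 0 then (1 : ℝ) else 0) - ∑ i ∈ Finset.range (M + 1), (-1) ^ i * (y.choose i : ℝ)|
      ≤ (y.choose (M + 1) : ℝ) := by
  rcases y with _ | y
  · rw [Finset.sum_range_succ']
    simp
  · have h := congrArg (Int.cast : ℤ → ℝ) (Int.alternating_sum_range_choose_eq_choose (n := y) (m := M))
    push_cast at h
    rw [h, if_neg (Nat.succ_ne_zero y), zero_sub, abs_neg, abs_mul, abs_pow, abs_neg, abs_one,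
      one_pow, one_mul, Nat.abs_cast]
    exact_mod_cast Nat.choose_succ_succ y M ▸ Nat.le_add_right _ _

lemma tendsto_exp_neg_of_bonferroni {a : ℕ → ℝ} {S : ℕ → ℕ → ℝ} {l : ℝ}
    (hS : ∀ i, Tendsto (S i) atTop (nhds (l ^ i / i.factorial)))
    (hb : ∀ M, ∀ᶠ n in atTop,
      |a n - ∑ i ∈ Finset.range (M + 1), (-1) ^ i * S i n| ≤ S (M + 1) n) :
    Tendsto a atTop (nhds (Real.exp (-l))) := by
  rw [Metric.tendsto_atTop']
  suffices H : ∀ ε > 0, ∀ᶠ n in atTop, dist (a n) (Real.exp (-l)) < ε by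
    intro ε hε
    obtain ⟨N, hN⟩ := eventually_atTop.1 (H ε hε)
    exact ⟨N, fun n hn => hN n hn.le⟩
  intro ε hε
  have h1 : Tendsto (fun M => ∑ i ∈ Finset.range M, (-l) ^ i / (i.factorial : ℝ)) atTop
      (nhds (Real.exp (-l))) := by
    have := (NormedSpace.expSeries_div_hasSum_exp (-l)).tendsto_sum_nat
    rwa [← Real.exp_eq_exp_ℝ] at this
  have h2 : Tendsto (fun M : ℕ => l ^ M / (M.factorial : ℝ)) atTop (nhds 0) :=
    FloorSemiring.tendsto_pow_div_factorial_atTop l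
  obtain ⟨M, hM1, hM2⟩ := (((h1.comp (tendsto_add_atTop_nat 1)).eventually
    (Metric.ball_mem_nhds _ (by positivity : (0 : ℝ) < ε / 3))).and
    ((h2.comp (tendsto_add_atTop_nat 1)).eventually_lt_const
      (by positivity : (0 : ℝ) < ε / 3))).exists
  have h3 : Tendsto (fun n => ∑ i ∈ Finset.range (M + 1), (-1) ^ i * S i n) atTop
      (nhds (∑ i ∈ Finset.range (M + 1), (-l) ^ i / (i.factorial : ℝ))) := by
    refine tendsto_finsetSum _ fun i _ => ?_
    rw [neg_pow l, mul_div_assoc]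
    exact (hS i).const_mul _
  filter_upwards [hb M, (hS (M + 1)).eventually_lt_const hM2,
    h3.eventually (Metric.ball_mem_nhds _ (by positivity : (0 : ℝ) < ε / 3))] with n hn1 hn2 hn3
  simp only [Function.comp, Real.dist_eq] at hM1 hn3 ⊢
  rw [abs_lt] at hM1 hn3 ⊢
  rw [abs_le] at hn1
  constructor <;> linarith

lemma lt_minDeg_iff {q n P : ℕ} (hn : 1 ≤ n) (j : ℕ) (ω : Config n P) :
    j < minDeg q n P ω ↔ lowCount q j ω = 0 := by
  have : Nonempty (Fin n) := ⟨⟨0, hn⟩⟩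
  rw [lowCount, Finset.card_eq_zero, Finset.filter_eq_empty_iff, minDeg]
  simp only [Finset.mem_univ, forall_const, not_le]
  constructor
  · intro h v
    exact h.trans_le (Nat.sInf_le ⟨v, rfl⟩)
  · intro h
    refine Nat.lt_of_succ_le (le_csInf (Set.range_nonempty _) ?_)
    rintro _ ⟨v, rfl⟩
    exact @h v

/-- The binomial moment of the number of vertices of degree at most `j`. -/
noncomputable def binomMoment (q j m n K P : ℕ) (p : ℝ) : ℝ :=
  ∑ ω : Config n P, weight n K P p ω * ((lowCount q j ω).choose m : ℝ)

lemma prob_eq (n K P : ℕ) (p : ℝ) (E : Set (Config n P)) [DecidablePred (· ∈ E)] :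
    prob n K P p E = ∑ ω : Config n P, weight n K P p ω * (if ω ∈ E then 1 else 0) := by
  unfold prob
  refine Finset.sum_congr rfl fun ω _ => ?_
  by_cases h : ω ∈ E <;> simp [h]

lemma prob_eq_succ {q n K P : ℕ} {p : ℝ} (hn : 1 ≤ n) (j : ℕ) :
    prob n K P p {ω | minDeg q n P ω = j + 1}
      = prob n K P p {ω | lowCount q j ω = 0} - prob n K P p {ω | lowCount q (j + 1) ω = 0} := by
  classical
  simp_rw [prob_eq, ← Finset.sum_sub_distrib, ← mul_sub, Set.mem_ofPred_eq, ← lt_minDeg_iff hn]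
  refine Finset.sum_congr rfl fun ω _ => ?_
  congr 1
  split_ifs <;> first | omega | norm_num

lemma prob_eq_zero {q n K P : ℕ} {p : ℝ} (hn : 1 ≤ n) (hK : K ≤ P) :
    prob n K P p {ω | minDeg q n P ω = 0} = 1 - prob n K P p {ω | lowCount q 0 ω = 0} := by
  classical
  rw [← sum_weight (n := n) (p := p) hK]
  simp_rw [prob_eq, ← Finset.sum_sub_distrib, Set.mem_ofPred_eq, ← lt_minDeg_iff hn]
  refine Finset.sum_congr rfl fun ω _ => ?_
  split_ifs <;> first | omega | norm_num

lemma abs_prob_sub_le {q n K P : ℕ} {p : ℝ} (hp0 : 0 ≤ p) (hp1 : p ≤ 1) (j M : ℕ) :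
    |prob n K P p {ω | lowCount q j ω = 0}
        - ∑ i ∈ Finset.range (M + 1), (-1) ^ i * binomMoment q j i n K P p|
      ≤ binomMoment q j (M + 1) n K P p := by
  classical
  have h : prob n K P p {ω | lowCount q j ω = 0}
        - ∑ i ∈ Finset.range (M + 1), (-1) ^ i * binomMoment q j i n K P p
      = ∑ ω : Config n P, weight n K P p ω * ((if lowCount q j ω = 0 then (1 : ℝ) else 0) -
          ∑ i ∈ Finset.range (M + 1), (-1) ^ i * ((lowCount q j ω).choose i : ℝ)) := by
    simp_rw [prob_eq, binomMoment, Set.mem_ofPred_eq, mul_sub, Finset.sum_sub_distrib,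
      Finset.mul_sum]
    rw [Finset.sum_comm]
    congr 1
    exact Finset.sum_congr rfl fun ω _ => Finset.sum_congr rfl fun i _ => by ring
  rw [h]
  refine (Finset.abs_sum_le_sum_abs _ _).trans (Finset.sum_le_sum fun ω _ => ?_)
  rw [abs_mul, abs_of_nonneg (weight_nonneg hp0 hp1 ω)]
  exact mul_le_mul_of_nonneg_left (abs_indicator_sub_le _ _) (weight_nonneg hp0 hp1 ω)

lemma prob_nonneg {n K P : ℕ} {p : ℝ} (hp0 : 0 ≤ p) (hp1 : p ≤ 1) (E : Set (Config n P)) :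
    0 ≤ prob n K P p E :=
  Finset.sum_nonneg fun ω _ => Set.indicator_nonneg (fun ω _ => weight_nonneg hp0 hp1 ω) ω

/-- Chebyshev's bound on the probability that no vertex has degree at most `j`. -/
lemma prob_le_of_pos {q n K P : ℕ} {p : ℝ} (hp0 : 0 ≤ p) (hp1 : p ≤ 1) (hK : K ≤ P) (j : ℕ)
    {μ : ℝ} (hμ : 0 < μ) :
    prob n K P p {ω | lowCount q j ω = 0}
      ≤ 2 * (binomMoment q j 2 n K P p / μ ^ 2) + binomMoment q j 1 n K P p / μ ^ 1 * μ⁻¹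
        - 2 * (binomMoment q j 1 n K P p / μ ^ 1) + 1 := by
  classical
  have h1 : 2 * (binomMoment q j 2 n K P p / μ ^ 2) + binomMoment q j 1 n K P p / μ ^ 1 * μ⁻¹
        - 2 * (binomMoment q j 1 n K P p / μ ^ 1) + 1
      = ∑ ω : Config n P, weight n K P p ω * (((lowCount q j ω : ℝ) - μ) ^ 2 / μ ^ 2) := by
    rw [← sum_weight (n := n) (p := p) hK]
    simp_rw [binomMoment, Finset.sum_div, Finset.sum_mul, Finset.mul_sum,
      ← Finset.sum_add_distrib, ← Finset.sum_sub_distrib, ← Finset.sum_add_distrib]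
    refine Finset.sum_congr rfl fun ω _ => ?_
    rw [Nat.cast_choose_two, Nat.choose_one_right]
    field_simp
    ring
  rw [h1, prob_eq]
  refine Finset.sum_le_sum fun ω _ =>
    mul_le_mul_of_nonneg_left ?_ (weight_nonneg hp0 hp1 ω)
  by_cases h : lowCount q j ω = 0
  · simp [h, hμ.ne']
  · simp only [Set.mem_ofPred_eq, h, if_false]
    positivity

namespace SparseRegime

variable {q : ℕ} {K P : ℕ → ℕ} {p : ℕ → ℝ}

lemma binomMoment_ratio (h : SparseRegime q K P p) (m j : ℕ) :
    Tendsto (fun n : ℕ => binomMoment q j m n (K n) (P n) (p n) /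
      (n * poissonMass q K P p j n) ^ m) atTop (nhds (1 / m.factorial)) := by
  obtain ⟨G, hG, hG'⟩ := h.exists_lower m j
  obtain ⟨G₂, hG₂, hG₂'⟩ := h.exists_upper m j
  have hc : Tendsto (fun n : ℕ => (n.choose m : ℝ) / (n : ℝ) ^ m) atTop
      (nhds (1 / m.factorial)) := by
    have := (tendsto_choose_sub_div 0 m).div_const (m.factorial : ℝ)
    refine this.congr fun n => ?_
    rw [Nat.sub_zero]
    field_simp
  have hb : ∀ n, binomMoment q j m n (K n) (P n) (p n)
      = ∑ V ∈ Finset.powersetCard m (Finset.univ : Finset (Fin n)),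
        ∑ ω : Config n (P n), weight n (K n) (P n) (p n) ω * lowDegInd q j V ω := by
    intro n
    simp_rw [binomMoment, choose_lowCount, Finset.mul_sum]
    exact Finset.sum_comm
  have hpos : ∀ᶠ n : ℕ in atTop, 0 < (n * poissonMass q K P p j n) ^ m := by
    filter_upwards [eventually_ge_atTop 1, h.meanDeg_tendsto.eventually_gt_atTop 0] with n hn hL
    unfold poissonMass
    positivity
  refine tendsto_of_tendsto_of_tendsto_of_le_of_le'
    (g := fun n : ℕ => (n.choose m : ℝ) / (n : ℝ) ^ m * G n)
    (h := fun n : ℕ => (n.choose m : ℝ) / (n : ℝ) ^ m * G₂ n)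
    (by simpa using hc.mul hG) (by simpa using hc.mul hG₂) ?_ ?_
  · filter_upwards [hG', hpos, eventually_ge_atTop 1] with n hn hp hn1
    rw [le_div_iff₀ hp, hb]
    have hn0 : (0 : ℝ) < n := by exact_mod_cast hn1
    calc (n.choose m : ℝ) / (n : ℝ) ^ m * G n * (n * poissonMass q K P p j n) ^ m
        = (n.choose m : ℝ) * (G n * poissonMass q K P p j n ^ m) := by
          rw [mul_pow]; field_simp
      _ = ∑ V ∈ Finset.powersetCard m (Finset.univ : Finset (Fin n)),
            G n * poissonMass q K P p j n ^ m := by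
          rw [Finset.sum_const, Finset.card_powersetCard, Finset.card_univ, Fintype.card_fin,
            nsmul_eq_mul]
      _ ≤ _ := Finset.sum_le_sum fun V hV => hn V (Finset.mem_powersetCard.1 hV).2
  · filter_upwards [hG₂', hpos, eventually_ge_atTop 1] with n hn hp hn1
    rw [div_le_iff₀ hp, hb]
    have hn0 : (0 : ℝ) < n := by exact_mod_cast hn1
    calc _ ≤ ∑ V ∈ Finset.powersetCard m (Finset.univ : Finset (Fin n)),
            G₂ n * poissonMass q K P p j n ^ m :=
          Finset.sum_le_sum fun V hV => hn V (Finset.mem_powersetCard.1 hV).2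
      _ = (n.choose m : ℝ) * (G₂ n * poissonMass q K P p j n ^ m) := by
          rw [Finset.sum_const, Finset.card_powersetCard, Finset.card_univ, Fintype.card_fin,
            nsmul_eq_mul]
      _ = _ := by
          rw [mul_pow]; field_simp

/-- Poisson limit for the number of vertices of degree at most `j`. -/
lemma prob_tendsto_exp (h : SparseRegime q K P p) (j : ℕ) {l : ℝ}
    (hl : Tendsto (fun n : ℕ => n * poissonMass q K P p j n) atTop (nhds l)) :
    Tendsto (fun n => prob n (K n) (P n) (p n) {ω | lowCount q j ω = 0}) atTop
      (nhds (Real.exp (-l))) := by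
  refine tendsto_exp_neg_of_bonferroni
    (S := fun i n => binomMoment q j i n (K n) (P n) (p n)) (fun i => ?_) fun M => ?_
  · have h1 := (h.binomMoment_ratio i j).mul (hl.pow i)
    rw [one_div_mul_eq_div] at h1
    refine h1.congr' ?_
    filter_upwards [eventually_ge_atTop 1, h.meanDeg_tendsto.eventually_gt_atTop 0] with n hn hL
    have : (n * poissonMass q K P p j n) ^ i ≠ 0 := by
      unfold poissonMass
      positivity
    exact div_mul_cancel₀ _ this
  · exact Eventually.of_forall fun n =>
      abs_prob_sub_le (h.channel_pos n).le (h.channel_le_one n) j M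

lemma prob_tendsto_zero (h : SparseRegime q K P p) (j : ℕ)
    (hl : Tendsto (fun n : ℕ => n * poissonMass q K P p j n) atTop atTop) :
    Tendsto (fun n => prob n (K n) (P n) (p n) {ω | lowCount q j ω = 0}) atTop (nhds 0) := by
  have h1 := h.binomMoment_ratio 1 j
  have h2 := h.binomMoment_ratio 2 j
  have h3 := (((h2.const_mul 2).add (h1.mul hl.inv_tendsto_atTop)).sub (h1.const_mul 2)).add_const 1
  have h4 : (2 : ℝ) * (1 / (Nat.factorial 2 : ℕ)) + 1 / (Nat.factorial 1 : ℕ) * 0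
      - 2 * (1 / (Nat.factorial 1 : ℕ)) + 1 = 0 := by
    norm_num [Nat.factorial]
  rw [h4] at h3
  refine squeeze_zero' (Eventually.of_forall fun n =>
    prob_nonneg (h.channel_pos n).le (h.channel_le_one n) _) ?_ h3
  filter_upwards [hl.eventually_gt_atTop 0] with n hn
  exact prob_le_of_pos (h.channel_pos n).le (h.channel_le_one n) (h.ring_le_pool n) j hn

end SparseRegime

end Counting

section Scaling

variable {q : ℕ} {K P : ℕ → ℕ} {p : ℕ → ℝ} {β : ℕ → ℝ} {βstar : ℝ} {h : ℕ}

lemma tendsto_log_natCast : Tendsto (fun n : ℕ => Real.log n) atTop atTop :=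
  Real.tendsto_log_atTop.comp tendsto_natCast_atTop_atTop

lemma meanDeg_div_log
    (hL : ∀ n : ℕ, 1 ≤ n → meanDeg q K P p n = Real.log n + h * Real.log (Real.log n) + β n)
    (hβ : Tendsto β atTop (nhds βstar)) :
    Tendsto (fun n : ℕ => meanDeg q K P p n / Real.log n) atTop (nhds 1) := by
  have h1 : Tendsto (fun n : ℕ => Real.log (Real.log n) / Real.log n) atTop (nhds 0) :=
    Real.isLittleO_log_id_atTop.tendsto_div_nhds_zero.comp tendsto_log_natCast
  have h2 := ((h1.const_mul (h : ℝ)).const_add 1).add (hβ.div_atTop tendsto_log_natCast)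
  rw [mul_zero, add_zero, add_zero] at h2
  refine h2.congr' ?_
  filter_upwards [eventually_ge_atTop 1, tendsto_log_natCast.eventually_gt_atTop 0] with n hn hlog
  rw [hL n hn]
  field_simp

lemma mul_poissonMass_eq
    (hL : ∀ n : ℕ, 1 ≤ n → meanDeg q K P p n = Real.log n + h * Real.log (Real.log n) + β n)
    (j : ℕ) : ∀ᶠ n : ℕ in atTop,
      (meanDeg q K P p n / Real.log n) ^ j * (Real.exp (-β n) / j.factorial) *
          (Real.log n ^ j / Real.log n ^ h)
        = n * SparseRegime.poissonMass q K P p j n := by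
  filter_upwards [eventually_ge_atTop 1, tendsto_log_natCast.eventually_gt_atTop 0] with n hn hlog
  have hn0 : (0 : ℝ) < n := by exact_mod_cast hn
  have h1 : Real.exp (-meanDeg q K P p n) = (n : ℝ)⁻¹ * (Real.log n ^ h)⁻¹ * Real.exp (-β n) := by
    rw [hL n hn, neg_add, neg_add, Real.exp_add, Real.exp_add, Real.exp_neg, Real.exp_log hn0,
      Real.exp_neg (h * _), Real.exp_nat_mul, Real.exp_log hlog]
  rw [SparseRegime.poissonMass, h1, div_pow]
  field_simp

lemma mul_poissonMass_tendsto
    (hL : ∀ n : ℕ, 1 ≤ n → meanDeg q K P p n = Real.log n + h * Real.log (Real.log n) + β n)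
    (hβ : Tendsto β atTop (nhds βstar)) :
    Tendsto (fun n : ℕ => n * SparseRegime.poissonMass q K P p h n) atTop
      (nhds (Real.exp (-βstar) / h.factorial)) := by
  have h1 := ((meanDeg_div_log hL hβ).pow h).mul
    (((Real.continuous_exp.tendsto _).comp hβ.neg).div_const (h.factorial : ℝ))
  rw [one_pow, one_mul] at h1
  refine h1.congr' ?_
  filter_upwards [mul_poissonMass_eq hL h, tendsto_log_natCast.eventually_gt_atTop 0] with n hn hlog
  rw [← hn, div_self (by positivity), mul_one]
  rfl

lemma mul_poissonMass_succ_tendsto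
    (hL : ∀ n : ℕ, 1 ≤ n → meanDeg q K P p n = Real.log n + h * Real.log (Real.log n) + β n)
    (hβ : Tendsto β atTop (nhds βstar)) :
    Tendsto (fun n : ℕ => n * SparseRegime.poissonMass q K P p (h + 1) n) atTop atTop := by
  have h1 := ((meanDeg_div_log hL hβ).pow (h + 1)).mul
    (((Real.continuous_exp.tendsto _).comp hβ.neg).div_const ((h + 1).factorial : ℝ))
  rw [one_pow, one_mul] at h1
  refine (h1.pos_mul_atTop (by positivity) tendsto_log_natCast).congr' ?_
  filter_upwards [mul_poissonMass_eq hL (h + 1), tendsto_log_natCast.eventually_gt_atTop 0]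
    with n hn hlog
  rw [← hn, pow_succ (Real.log n) h, mul_div_cancel_left₀ _ (by positivity)]
  rfl

lemma mul_poissonMass_pred_tendsto
    (hL : ∀ n : ℕ, 1 ≤ n →
      meanDeg q K P p n = Real.log n + (h + 1 : ℕ) * Real.log (Real.log n) + β n)
    (hβ : Tendsto β atTop (nhds βstar)) :
    Tendsto (fun n : ℕ => n * SparseRegime.poissonMass q K P p h n) atTop (nhds 0) := by
  have h1 := (((meanDeg_div_log hL hβ).pow h).mul
    (((Real.continuous_exp.tendsto _).comp hβ.neg).div_const (h.factorial : ℝ))).mul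
    tendsto_log_natCast.inv_tendsto_atTop
  rw [mul_zero] at h1
  refine h1.congr' ?_
  filter_upwards [mul_poissonMass_eq hL h, tendsto_log_natCast.eventually_gt_atTop 0] with n hn hlog
  rw [← hn, pow_succ (Real.log n) h, div_mul_cancel_left₀ (by positivity)]
  rfl

/-- The minimum degree is concentrated on `h` and `h + 1`. -/
lemma minDeg_limits (hq : 1 ≤ q) (hK1 : ∀ n, 1 ≤ K n) (hKP : ∀ n, K n ≤ P n)
    (hp : ∀ n, p n ∈ Set.Ioc (0 : ℝ) 1)
    (hKinf : Tendsto (fun n => (K n : ℝ)) atTop atTop)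
    (hKsqP : Tendsto (fun n => ((K n : ℝ)) ^ 2 / (P n : ℝ)) atTop (nhds 0))
    (hL : ∀ n : ℕ, 1 ≤ n → meanDeg q K P p n = Real.log n + h * Real.log (Real.log n) + β n)
    (hβ : Tendsto β atTop (nhds βstar)) :
    Tendsto (fun n => prob n (K n) (P n) (p n) {ω | minDeg q n (P n) ω = h + 1}) atTop
        (nhds (Real.exp (-(Real.exp (-βstar) / h.factorial)))) ∧
      Tendsto (fun n => prob n (K n) (P n) (p n) {ω | minDeg q n (P n) ω = h}) atTop
        (nhds (1 - Real.exp (-(Real.exp (-βstar) / h.factorial)))) := by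
  have hratio := meanDeg_div_log hL hβ
  have hS : SparseRegime q K P p := by
    refine ⟨hq, hK1, hKP, fun n => (hp n).1, fun n => (hp n).2, hKinf, hKsqP, ?_, ?_⟩
    · refine (hratio.pos_mul_atTop one_pos tendsto_log_natCast).congr' ?_
      filter_upwards [tendsto_log_natCast.eventually_gt_atTop 0] with n hlog
      exact div_mul_cancel₀ _ hlog.ne'
    · filter_upwards [hratio.eventually_le_const (u := 2) (by norm_num),
        tendsto_log_natCast.eventually_gt_atTop 0] with n hn hlog
      rwa [div_le_iff₀ hlog] at hn
  have hmid := hS.prob_tendsto_exp h (mul_poissonMass_tendsto hL hβ)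
  constructor
  · have hhigh := hS.prob_tendsto_zero (h + 1) (mul_poissonMass_succ_tendsto hL hβ)
    have := hmid.sub hhigh
    rw [sub_zero] at this
    refine this.congr' ?_
    filter_upwards [eventually_ge_atTop 1] with n hn
    exact (prob_eq_succ hn h).symm
  · rcases h with _ | g
    · refine (hmid.const_sub 1).congr' ?_
      filter_upwards [eventually_ge_atTop 1] with n hn
      exact (prob_eq_zero hn (hKP n)).symm
    · have hlow := hS.prob_tendsto_exp g (mul_poissonMass_pred_tendsto hL hβ)
      rw [neg_zero, Real.exp_zero] at hlow
      refine (hlow.sub hmid).congr' ?_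
      filter_upwards [eventually_ge_atTop 1] with n hn
      exact (prob_eq_succ hn g).symm

end Scaling

/-- under the fine-grained scaling
`p_{e,q}(n) = (ln n + (k−1) ln ln n + b ln ln n + β_n)/n` with `k + b ≥ 1` and
`−1 < liminf β_n/ln ln n ≤ limsup β_n/ln ln n < 1` (i.e.,
`c₁ ln ln n ≤ β_n ≤ c₂ ln ln n` eventually, for constants `−1 < c₁ ≤ c₂ < 1`),
if `β_n → β* ∈ ℝ` then `P[min degree = k+b] → exp(−e^{−β*}/(k+b−1)!)` and
`P[min degree = k+b−1] → 1 − exp(−e^{−β*}/(k+b−1)!)`. -/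
theorem min_degree_distribution_beta_finite
    (q : ℕ) (hq : 1 ≤ q) (k : ℕ) (hk : 1 ≤ k) (b : ℤ)
    (K P : ℕ → ℕ) (p : ℕ → ℝ) (β : ℕ → ℝ)
    (c₁ c₂ : ℝ) (hc₁ : -1 < c₁) (hc₁₂ : c₁ ≤ c₂) (hc₂ : c₂ < 1)
    (hK1 : ∀ n, 1 ≤ K n) (hKP : ∀ n, K n ≤ P n)
    (hp : ∀ n, p n ∈ Set.Ioc (0 : ℝ) 1)
    (hKinf : Tendsto (fun n => (K n : ℝ)) atTop atTop)
    (hKsqP : Tendsto (fun n => ((K n : ℝ)) ^ 2 / (P n : ℝ)) atTop (nhds 0))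
    (hpe : ∀ n : ℕ, peq q (K n) (P n) (p n)
      = (Real.log (n : ℝ) + ((k : ℝ) - 1) * Real.log (Real.log (n : ℝ))
          + (b : ℝ) * Real.log (Real.log (n : ℝ)) + β n) / (n : ℝ))
    (hβbound : ∀ᶠ (n : ℕ) in atTop,
      c₁ * Real.log (Real.log (n : ℝ)) ≤ β n ∧ β n ≤ c₂ * Real.log (Real.log (n : ℝ)))
    (hkb : 1 ≤ (k : ℤ) + b) (βstar : ℝ) (hβ : Tendsto β atTop (nhds βstar)) :
    Tendsto (fun n => prob n (K n) (P n) (p n)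
        {ω | (minDeg q n (P n) ω : ℤ) = (k : ℤ) + b})
      atTop (nhds (Real.exp (-(Real.exp (-βstar) / (Nat.factorial (((k : ℤ) + b - 1).toNat) : ℝ)))))
    ∧
    Tendsto (fun n => prob n (K n) (P n) (p n)
        {ω | (minDeg q n (P n) ω : ℤ) = (k : ℤ) + b - 1})
      atTop (nhds (1 - Real.exp (-(Real.exp (-βstar) / (Nat.factorial (((k : ℤ) + b - 1).toNat) : ℝ))))) := by
  obtain ⟨h, hh⟩ : ∃ h : ℕ, (k : ℤ) + b = h + 1 := ⟨((k : ℤ) + b - 1).toNat, by omega⟩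
  have hhR : (k : ℝ) + b = h + 1 := by exact_mod_cast hh
  have hL : ∀ n : ℕ, 1 ≤ n →
      meanDeg q K P p n = Real.log n + h * Real.log (Real.log n) + β n := by
    intro n hn
    have hn0 : (n : ℝ) ≠ 0 := by positivity
    rw [meanDeg, hpe, mul_div_cancel₀ _ hn0]
    linear_combination Real.log (Real.log n) * hhR
  have hnat : ((k : ℤ) + b - 1).toNat = h := by omega
  have hset1 : ∀ n, {ω | (minDeg q n (P n) ω : ℤ) = (k : ℤ) + b}
      = {ω | minDeg q n (P n) ω = h + 1} := fun n => by
    ext ω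
    simp only [Set.mem_ofPred_eq]
    omega
  have hset2 : ∀ n, {ω | (minDeg q n (P n) ω : ℤ) = (k : ℤ) + b - 1}
      = {ω | minDeg q n (P n) ω = h} := fun n => by
    ext ω
    simp only [Set.mem_ofPred_eq]
    omega
  simp_rw [hset1, hset2, hnat]
  exact minDeg_limits hq hK1 hKP hp hKinf hKsqP hL hβ
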